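/- arXiv:2502.11243 — 4 statements merged into one kernel-verified Lean document; each statement's English description precedes it below -/
import Mathlib

section
/- Let S be a solution concept that permits bracketing and satisfies expectation-neutrality, interiority, expectation-monotonicity, and anonymity. Then there exists λ ≥ 0 such that S is a refinement of LQRE_λ. -/
open Filter Topology MeasureTheory

noncomputable section

namespace Paper

/-! ## Lotteries as finitely supported probability mass functions on ℝ -/

open Classical in
/-- The point mass at `a`. -/
def delta {α : Type*} (a : α) : α → ℝ := fun b => if b = a then 1 else 0

/-- `f` is (the p.m.f. of) a finitely supported lottery. -/
def IsFinLottery (f : ℝ → ℝ) : Prop :=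
  (∀ x, 0 ≤ f x) ∧ (Function.support f).Finite ∧ ∑ᶠ x, f x = 1

/-- The CDF of a mass function. -/
def cdfOf (f : ℝ → ℝ) (t : ℝ) : ℝ := ∑ᶠ x, if x ≤ t then f x else 0

/-- Convolution: the distribution of the sum of independent draws. -/
def conv (f g : ℝ → ℝ) : ℝ → ℝ := fun z => ∑ᶠ x, f x * g (z - x)

/-- Expectation of a finitely supported lottery. -/
def expOf (f : ℝ → ℝ) : ℝ := ∑ᶠ x, x * f x

/-- Weak first-order stochastic dominance of `f` over `g`. -/
def FOSDgeF (f g : ℝ → ℝ) : Prop := ∀ t, cdfOf f t ≤ cdfOf g t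

/-- Strict first-order stochastic dominance of `f` over `g`. -/
def FOSDgtF (f g : ℝ → ℝ) : Prop := FOSDgeF f g ∧ f ≠ g

/-- Finitely supported lotteries with rational-valued CDF (`Δ_ℚ`). -/
def IsDeltaQ (f : ℝ → ℝ) : Prop := IsFinLottery f ∧ ∀ t, ∃ q : ℚ, cdfOf f t = (q : ℝ)

/-- Monotone additive statistic on all finitely supported lotteries. -/
def MAS (Φ : (ℝ → ℝ) → ℝ) : Prop :=
  (∀ c : ℝ, Φ (delta c) = c) ∧
  (∀ f g, IsFinLottery f → IsFinLottery g → Φ (conv f g) = Φ f + Φ g) ∧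
  (∀ f g, IsFinLottery f → IsFinLottery g → FOSDgeF f g → Φ g ≤ Φ f)

/-- Monotone additive statistic on `Δ_ℚ`. -/
def MASQ (Φ : (ℝ → ℝ) → ℝ) : Prop :=
  (∀ c : ℝ, Φ (delta c) = c) ∧
  (∀ f g, IsDeltaQ f → IsDeltaQ g → Φ (conv f g) = Φ f + Φ g) ∧
  (∀ f g, IsDeltaQ f → IsDeltaQ g → FOSDgeF f g → Φ g ≤ Φ f)

/-- The statistic `K_a` for `a` in the extended real line. -/
def Kstat (a : EReal) (f : ℝ → ℝ) : ℝ :=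
  if a = ⊤ then sSup (Function.support f)
  else if a = ⊥ then sInf (Function.support f)
  else if a = 0 then expOf f
  else (a.toReal)⁻¹ * Real.log (∑ᶠ x, Real.exp (a.toReal * x) * f x)

/-- `K_a` for real `a`. -/
def Kreal (a : ℝ) : (ℝ → ℝ) → ℝ := Kstat (a : EReal)

/-- The statistic `Φ[X] = ∫ K_a[X] dμ(a)`. -/
def PhiInt (μ : Measure EReal) (f : ℝ → ℝ) : ℝ := ∫ a, Kstat a f ∂μ

/-! ## Finite normal-form games -/

structure Game (N : ℕ) where
  A : Fin N → Type
  fintypeA : ∀ i, Fintype (A i)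
  nonemptyA : ∀ i, Nonempty (A i)
  u : ((i : Fin N) → A i) → Fin N → ℝ

instance {N : ℕ} (G : Game N) (i : Fin N) : Fintype (G.A i) := G.fintypeA i
instance {N : ℕ} (G : Game N) (i : Fin N) : Nonempty (G.A i) := G.nonemptyA i

/-- A (mixed strategy) profile: a real-valued function on each action set. -/
abbrev Profile {N : ℕ} (G : Game N) := (i : Fin N) → G.A i → ℝ

/-- `p` is a mixed strategy profile. -/
def IsMixed {N : ℕ} (G : Game N) (p : Profile G) : Prop :=
  ∀ i, (∀ ai, 0 ≤ p i ai) ∧ ∑ ai, p i ai = 1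

/-- Probability of the full action profile `a` under independent mixing `p`. -/
def weight {N : ℕ} (G : Game N) (p : Profile G) (a : (i : Fin N) → G.A i) : ℝ :=
  ∏ j, p j (a j)

/-- The p.m.f. of player `i`'s payoff lottery `u_i(a_i, p_{-i})`. -/
def payMass {N : ℕ} (G : Game N) (p : Profile G) (i : Fin N) (ai : G.A i) : ℝ → ℝ :=
  fun t => ∑ a : (j : Fin N) → G.A j,
    if G.u a i = t then weight G (Function.update p i (delta ai)) a else 0

/-- Expected payoff `E[u_i(a_i, p_{-i})]`. -/
def expPay {N : ℕ} (G : Game N) (p : Profile G) (i : Fin N) (ai : G.A i) : ℝ :=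
  ∑ a : (j : Fin N) → G.A j, weight G (Function.update p i (delta ai)) a * G.u a i

/-- Expected value of `f` applied to player `i`'s payoff lottery. -/
def expPayOf {N : ℕ} (G : Game N) (p : Profile G) (i : Fin N) (ai : G.A i) (f : ℝ → ℝ) : ℝ :=
  ∑ a : (j : Fin N) → G.A j, weight G (Function.update p i (delta ai)) a * f (G.u a i)

/-- Minimum over `a_{-i}` of `u_i(a_i, a_{-i})`. -/
def minPay {N : ℕ} (G : Game N) (i : Fin N) (ai : G.A i) : ℝ :=
  ⨅ a : (j : Fin N) → G.A j, G.u (Function.update a i ai) i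

/-- Maximum over `a_{-i}` of `u_i(a_i, a_{-i})`. -/
def maxPay {N : ℕ} (G : Game N) (i : Fin N) (ai : G.A i) : ℝ :=
  ⨆ a : (j : Fin N) → G.A j, G.u (Function.update a i ai) i

/-- `a_i` is strictly dominated (by some `b_i`). -/
def StrictlyDominated {N : ℕ} (G : Game N) (i : Fin N) (ai : G.A i) : Prop :=
  ∃ bi : G.A i, ∀ a : (j : Fin N) → G.A j,
    G.u (Function.update a i ai) i < G.u (Function.update a i bi) i

/-! ## Solution concepts and axioms -/

abbrev SolCon (N : ℕ) := (G : Game N) → Set (Profile G)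

/-- A solution concept assigns to each game a nonempty set of mixed strategy profiles. -/
def IsSolutionConcept {N : ℕ} (S : SolCon N) : Prop :=
  ∀ G, (S G).Nonempty ∧ ∀ p ∈ S G, IsMixed G p

/-- The composite game `G ⊗ H`. -/
def Game.comp {N : ℕ} (G H : Game N) : Game N where
  A := fun i => G.A i × H.A i
  fintypeA := fun i => inferInstance
  nonemptyA := fun i => inferInstance
  u := fun c i => G.u (fun j => (c j).1) i + H.u (fun j => (c j).2) i

/-- The product profile `p × q`. -/
def prodProfile {N : ℕ} {G H : Game N} (p : Profile G) (q : Profile H) :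
    Profile (G.comp H) := fun i ab => p i ab.1 * q i ab.2

def Bracketing {N : ℕ} (S : SolCon N) : Prop :=
  ∀ (G H : Game N) (p : Profile G) (q : Profile H),
    p ∈ S G → q ∈ S H → prodProfile p q ∈ S (G.comp H)

/-- The permuted game `G_π`. -/
def Game.permute {N : ℕ} (G : Game N) (π : Equiv.Perm (Fin N)) : Game N where
  A := fun i => G.A (π i)
  fintypeA := fun i => G.fintypeA (π i)
  nonemptyA := fun i => G.nonemptyA (π i)
  u := fun b i =>
    G.u (fun j => cast (congrArg G.A (π.apply_symm_apply j)) (b (π.symm j))) (π i)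

def Anonymity {N : ℕ} (S : SolCon N) : Prop :=
  ∀ (π : Equiv.Perm (Fin N)) (G : Game N) (p : Profile G),
    p ∈ S G → (fun i => p (π i)) ∈ S (G.permute π)

def ExpectationMonotone {N : ℕ} (S : SolCon N) : Prop :=
  ∀ G, ∀ p ∈ S G, ∀ i, ∀ ai bi : G.A i,
    expPay G p i bi < expPay G p i ai → p i bi ≤ p i ai

def ExpectationNeutral {N : ℕ} (S : SolCon N) : Prop :=
  ∀ G, ∀ p ∈ S G, ∀ i, ∀ ai bi : G.A i,
    expPay G p i ai = expPay G p i bi → p i ai = p i bi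

def DistributionMonotone {N : ℕ} (S : SolCon N) : Prop :=
  ∀ G, ∀ p ∈ S G, ∀ i, ∀ ai bi : G.A i,
    FOSDgtF (payMass G p i ai) (payMass G p i bi) → p i bi ≤ p i ai

def Interiority {N : ℕ} (S : SolCon N) : Prop :=
  ∀ G, ∀ p ∈ S G, ∀ i, ∀ ai : G.A i, 0 < p i ai

/-- The game with payoffs rescaled by `α`. -/
def Game.scale {N : ℕ} (G : Game N) (α : ℝ) : Game N :=
  { G with u := fun a i => α * G.u a i }

def ScaleInvariant {N : ℕ} (S : SolCon N) : Prop :=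
  ∀ G : Game N, ∀ p ∈ S G,
    (∀ i, ∀ ai : G.A i, p i ai = ((Fintype.card (G.A i) : ℝ))⁻¹) →
    ∀ α ∈ Set.Ioo (0 : ℝ) 1, p ∈ S (G.scale α)

def StratInvariant {N : ℕ} (S : SolCon N) : Prop :=
  ∀ (G : Game N) (u' : ((i : Fin N) → G.A i) → Fin N → ℝ),
    (∀ i, ∃ w : ((j : Fin N) → G.A j) → ℝ,
      (∀ a, ∀ bi : G.A i, w (Function.update a i bi) = w a) ∧
      (∀ a, u' a i = G.u a i + w a)) →
    S G = S { G with u := u' }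

/-! ## Equilibrium notions -/

def IsNash {N : ℕ} (G : Game N) (p : Profile G) : Prop :=
  ∀ i, ∀ ai : G.A i, 0 < p i ai → ∀ bi : G.A i, expPay G p i bi ≤ expPay G p i ai

def IsLQRE {N : ℕ} (lam : ℝ) (G : Game N) (p : Profile G) : Prop :=
  ∀ i, ∀ ai : G.A i,
    p i ai = Real.exp (lam * expPay G p i ai) / ∑ bi, Real.exp (lam * expPay G p i bi)

def IsNashPhi {N : ℕ} (Φ : (ℝ → ℝ) → ℝ) (G : Game N) (p : Profile G) : Prop :=
  ∀ i, ∀ ai : G.A i, 0 < p i ai → ∀ bi : G.A i,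
    Φ (payMass G p i bi) ≤ Φ (payMass G p i ai)

def IsLQREPhi {N : ℕ} (Φ : (ℝ → ℝ) → ℝ) (lam : ℝ) (G : Game N) (p : Profile G) : Prop :=
  ∀ i, ∀ ai : G.A i,
    p i ai = Real.exp (lam * Φ (payMass G p i ai)) /
      ∑ bi, Real.exp (lam * Φ (payMass G p i bi))

def IsFOSDNash {N : ℕ} (G : Game N) (p : Profile G) : Prop :=
  ∀ i, ∀ ai : G.A i,
    (∃ bi : G.A i, FOSDgtF (payMass G p i bi) (payMass G p i ai)) → p i ai = 0

def IsFOSDQRE {N : ℕ} (G : Game N) (p : Profile G) : Prop :=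
  (∀ i, ∀ ai : G.A i, 0 < p i ai) ∧
  ∀ i, ∀ ai bi : G.A i,
    FOSDgeF (payMass G p i ai) (payMass G p i bi) → p i bi ≤ p i ai

def IsMinMaxMean {N : ℕ} (l1 l2 l3 : ℝ) (G : Game N) (p : Profile G) : Prop :=
  ∀ i, ∀ ai : G.A i,
    p i ai = Real.exp (l1 * minPay G i ai + l2 * expPay G p i ai + l3 * maxPay G i ai) /
      ∑ bi, Real.exp (l1 * minPay G i bi + l2 * expPay G p i bi + l3 * maxPay G i bi)

def CompatibleEU {N : ℕ} (S : SolCon N) : Prop :=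
  ∃ f : ℝ → ℝ, StrictMono f ∧ Continuous f ∧
    ∀ G, ∀ p ∈ S G, ∀ i, ∀ ai bi : G.A i,
      expPayOf G p i bi f < expPayOf G p i ai f → p i bi ≤ p i ai

/-! ## Lotteries as compactly supported probability measures on ℝ -/

/-- Convolution of measures: distribution of the sum of independent draws. -/
def mconv (μ ν : Measure ℝ) : Measure ℝ := (μ.prod ν).map (fun z : ℝ × ℝ => z.1 + z.2)

/-- `npow μ m` is the `m`-fold convolution `μ^m`. -/
def npow (μ : Measure ℝ) : ℕ → Measure ℝ
  | 0 => Measure.dirac 0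
  | n + 1 => mconv (npow μ n) μ

/-- The distribution of `β` times a draw from `μ`. -/
def mscale (β : ℝ) (μ : Measure ℝ) : Measure ℝ := μ.map (fun x => β * x)

/-- `μ` is compactly supported. -/
def CompSupp (μ : Measure ℝ) : Prop := ∃ a b : ℝ, μ (Set.Icc a b)ᶜ = 0

/-- The minimum of the support of `μ`. -/
def minSupp (μ : Measure ℝ) : ℝ := sSup {x : ℝ | μ (Set.Iio x) = 0}

/-- The maximum of the support of `μ`. -/
def maxSupp (μ : Measure ℝ) : ℝ := sInf {x : ℝ | μ (Set.Ioi x) = 0}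

/-- Weak first-order stochastic dominance of `μ` over `ν`. -/
def FOSDgeM (μ ν : Measure ℝ) : Prop := ∀ t, μ (Set.Iic t) ≤ ν (Set.Iic t)

/-- Strict first-order stochastic dominance of `μ` over `ν`. -/
def FOSDgtM (μ ν : Measure ℝ) : Prop := FOSDgeM μ ν ∧ μ ≠ ν

/-- Monotone additive statistic on compactly supported lotteries (as measures). -/
def MASm (Φ : Measure ℝ → ℝ) : Prop :=
  (∀ c : ℝ, Φ (Measure.dirac c) = c) ∧
  (∀ μ ν : Measure ℝ, IsProbabilityMeasure μ → IsProbabilityMeasure ν →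
    CompSupp μ → CompSupp ν → Φ (mconv μ ν) = Φ μ + Φ ν) ∧
  (∀ μ ν : Measure ℝ, IsProbabilityMeasure μ → IsProbabilityMeasure ν →
    CompSupp μ → CompSupp ν → FOSDgeM μ ν → Φ ν ≤ Φ μ)

/-! ## Two-player games, unbundled -/

/-- `p` is a probability distribution on the finite type `α`. -/
def IsDist {α : Type*} [Fintype α] (p : α → ℝ) : Prop :=
  (∀ a, 0 ≤ p a) ∧ ∑ a, p a = 1

/-- Payoff lottery of player 1 playing `a` against the mixed strategy `q`. -/
def mass1 {α β : Type*} [Fintype β] (u : α → β → ℝ) (q : β → ℝ) (a : α) : ℝ → ℝ :=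
  fun t => ∑ b, if u a b = t then q b else 0

/-- Payoff lottery of player 2 playing `b` against the mixed strategy `p`. -/
def mass2 {α β : Type*} [Fintype α] (u : α → β → ℝ) (p : α → ℝ) (b : β) : ℝ → ℝ :=
  fun t => ∑ a, if u a b = t then p a else 0

/-- The distribution of a random variable on the uniform space `{1,…,m}`. -/
def distOf {m : ℕ} (X : Fin m → ℝ) : ℝ → ℝ :=
  fun t => (∑ ω : Fin m, if X ω = t then (1 : ℝ) else 0) / m

/-! ## Expected payoffs in special and composite games -/

lemma sum_weight {N : ℕ} (G : Game N) (p : Profile G) (hp : ∀ i, ∑ a, p i a = 1) :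
    ∑ a : (j : Fin N) → G.A j, weight G p a = 1 := by
  classical
  have h := Finset.prod_univ_sum (fun j => (Finset.univ : Finset (G.A j))) p
  rw [Fintype.piFinset_univ] at h
  simp only [weight]
  rw [← h]
  simp [hp]

lemma sum_update_delta {N : ℕ} {G : Game N} {p : Profile G} (hp : IsMixed G p) (i : Fin N)
    (ai : G.A i) (j : Fin N) : ∑ a, Function.update p i (delta ai) j a = 1 := by
  classical
  rcases eq_or_ne j i with rfl | hj
  · simp [delta]
  · simpa [hj] using (hp j).2

lemma expPay_eq_of_own_action {N : ℕ} {G : Game N} {p : Profile G} (hp : IsMixed G p) (i : Fin N)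
    (g : G.A i → ℝ) (hg : ∀ a, G.u a i = g (a i)) (ai : G.A i) : expPay G p i ai = g ai := by
  classical
  have h : ∀ a : (j : Fin N) → G.A j,
      weight G (Function.update p i (delta ai)) a * G.u a i =
        weight G (Function.update p i (delta ai)) a * g ai := by
    intro a
    by_cases ha : a i = ai
    · rw [hg, ha]
    · have : weight G (Function.update p i (delta ai)) a = 0 :=
        Finset.prod_eq_zero (Finset.mem_univ i) (by simp [delta, ha])
      simp [this]
  rw [expPay, Finset.sum_congr rfl fun a _ => h a, ← Finset.sum_mul,
    sum_weight _ _ (sum_update_delta hp i ai), one_mul]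

lemma weight_prodProfile {N : ℕ} {G H : Game N} (p : Profile G) (q : Profile H)
    (c : (j : Fin N) → (G.comp H).A j) :
    weight (G.comp H) (prodProfile p q) c =
      weight G p (fun j => (c j).1) * weight H q (fun j => (c j).2) := by
  simp only [weight, prodProfile, Finset.prod_mul_distrib]

lemma update_prodProfile {N : ℕ} {G H : Game N} (p : Profile G) (q : Profile H) (i : Fin N)
    (a : G.A i) (b : H.A i) :
    Function.update (prodProfile p q) i (delta ((a, b) : G.A i × H.A i)) =
      prodProfile (Function.update p i (delta a)) (Function.update q i (delta b)) := by
  classical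
  funext j c
  rcases eq_or_ne j i with rfl | hj
  · obtain ⟨c, d⟩ := c
    simp only [prodProfile, Function.update_self, delta]
    by_cases hc : c = a <;> by_cases hd : d = b <;> simp [Game.comp, hc, hd]
  · simp [prodProfile, hj]

lemma expPay_comp {N : ℕ} {G H : Game N} {p : Profile G} {q : Profile H} (hp : IsMixed G p)
    (hq : IsMixed H q) (i : Fin N) (a : G.A i) (b : H.A i) :
    expPay (G.comp H) (prodProfile p q) i (a, b) = expPay G p i a + expPay H q i b := by
  have hP := sum_weight G _ (sum_update_delta hp i a)
  have hQ := sum_weight H _ (sum_update_delta hq i b)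
  unfold expPay
  rw [update_prodProfile]
  simp only [weight_prodProfile]
  set w := weight G (Function.update p i (delta a))
  set w' := weight H (Function.update q i (delta b))
  have e : ∑ c : (j : Fin N) → (G.comp H).A j,
      w (fun j => (c j).1) * w' (fun j => (c j).2) * (G.comp H).u c i =
      ∑ x : ((j : Fin N) → G.A j) × ((j : Fin N) → H.A j),
        w x.1 * w' x.2 * (G.u x.1 i + H.u x.2 i) :=
    Fintype.sum_equiv (Equiv.arrowProdEquivProdArrow (Fin N) G.A H.A) _ _ fun _ => rfl
  rw [e, Fintype.sum_prod_type]
  have h : ∀ x, ∑ y, w x * w' y * (G.u x i + H.u y i) =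
      w x * G.u x i + w x * ∑ y, w' y * H.u y i := by
    intro x
    calc _ = w x * G.u x i * ∑ y, w' y + w x * ∑ y, w' y * H.u y i := by
          rw [Finset.mul_sum, Finset.mul_sum, ← Finset.sum_add_distrib]
          exact Finset.sum_congr rfl fun y _ => by ring
      _ = _ := by rw [hQ, mul_one]
  simp only [h]
  rw [Finset.sum_add_distrib, ← Finset.sum_mul, hP, one_mul]

/-- The binary-action game in which each player gets `d` for playing `true`, and `0` otherwise. -/
def bonusGame (N : ℕ) (d : ℝ) : Game N where
  A := fun _ => Bool
  fintypeA := fun _ => inferInstance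
  nonemptyA := fun _ => inferInstance
  u := fun a i => if a i then d else 0

lemma bonusGame_perm_mem {N : ℕ} {S : SolCon N} (hAn : Anonymity S) {d : ℝ}
    {p : Fin N → Bool → ℝ} (hp : p ∈ S (bonusGame N d)) (π : Equiv.Perm (Fin N)) :
    (fun i => p (π i)) ∈ S (bonusGame N d) := by
  have h := hAn π (bonusGame N d) p hp
  have key : ∀ u' : (Fin N → Bool) → Fin N → ℝ, u' = (bonusGame N d).u →
      (fun i => p (π i)) ∈ S { bonusGame N d with u := u' } →
      (fun i => p (π i)) ∈ S (bonusGame N d) := by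
    rintro _ rfl h
    exact h
  refine key _ ?_ h
  funext (b : Fin N → Bool) i
  change (if b (π.symm (π i)) then d else 0) = if b i then d else 0
  rw [π.symm_apply_apply]

lemma expPay_bonusGame {N : ℕ} {d : ℝ} {q : Profile (bonusGame N d)}
    (hq : IsMixed (bonusGame N d) q) (i : Fin N) (b : Bool) :
    expPay (bonusGame N d) q i b = if b then d else 0 :=
  expPay_eq_of_own_action hq i (fun b : Bool => if b then d else 0) (fun _ => rfl) b

/-! ## Log-odds as a function of the expected payoff difference -/

/-- By neutrality in the composite game, equal payoff differences give equal log-odds. -/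
lemma log_ratio_eq {N : ℕ} {S : SolCon N} (hS : IsSolutionConcept S) (hBr : Bracketing S)
    (hEN : ExpectationNeutral S) (hInt : Interiority S) {G H : Game N} {p : Profile G}
    {q : Profile H} (hp : p ∈ S G) (hq : q ∈ S H) (i : Fin N) (a a' : G.A i) (b b' : H.A i)
    (h : expPay G p i a - expPay G p i a' = expPay H q i b - expPay H q i b') :
    Real.log (p i a) - Real.log (p i a') = Real.log (q i b) - Real.log (q i b') := by
  have hm := (hS G).2 p hp
  have hm' := (hS H).2 q hq
  have key := hEN _ _ (hBr G H p q hp hq) i (a, b') (a', b)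
    (by rw [expPay_comp hm hm', expPay_comp hm hm']; linarith)
  simp only [prodProfile] at key
  have hl := congrArg Real.log key
  rw [Real.log_mul (hInt G p hp i a).ne' (hInt H q hq i b').ne',
    Real.log_mul (hInt G p hp i a').ne' (hInt H q hq i b).ne'] at hl
  linarith

lemma eq_mul_of_additive_of_nonneg (f : ℝ → ℝ) (hadd : ∀ x y, f (x + y) = f x + f y)
    (hpos : ∀ x, 0 < x → 0 ≤ f x) (x : ℝ) : f x = f 1 * x := by
  let F : ℝ →+ ℝ := AddMonoidHom.mk' f hadd
  have hmono : Monotone F := by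
    intro x y hxy
    rcases hxy.eq_or_lt with rfl | hlt
    · exact le_rfl
    · have h1 := hadd x (y - x)
      rw [add_sub_cancel] at h1
      have h2 := hpos (y - x) (sub_pos.2 hlt)
      change f x ≤ f y
      linarith
  have hc : Continuous F := MeasureTheory.Measure.AddMonoidHom.continuous_of_measurable F hmono.measurable
  have h := map_real_smul F hc x 1
  simp only [smul_eq_mul, mul_one] at h
  exact h.trans (mul_comm _ _)

lemma eq_exp_div_sum {α : Type*} [Fintype α] [Nonempty α] {p e : α → ℝ} (hp : ∀ a, 0 < p a)
    (hsum : ∑ a, p a = 1) (h : ∀ a b, Real.log (p a) - Real.log (p b) = e a - e b) (a : α) :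
    p a = Real.exp (e a) / ∑ b, Real.exp (e b) := by
  have hb : ∀ b, Real.exp (e b) = p b * (Real.exp (e a) / p a) := by
    intro b
    rw [← Real.exp_log (hp b), ← Real.exp_log (hp a), ← Real.exp_sub, ← Real.exp_add]
    congr 1
    linarith [h a b]
  have hs : ∑ b, Real.exp (e b) = Real.exp (e a) / p a := by
    rw [Finset.sum_congr rfl fun b _ => hb b, ← Finset.sum_mul, hsum, one_mul]
  rw [hs, div_div_cancel₀ (Real.exp_pos _).ne']

/-- bracketing + expectation-neutrality + interiority +
expectation-monotonicity + anonymity imply that `S` refines `LQRE_λ` for some `λ ≥ 0`. -/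
theorem stmt11 {N : ℕ} (hN : 2 ≤ N) (S : SolCon N) (hS : IsSolutionConcept S)
    (hBr : Bracketing S) (hEN : ExpectationNeutral S) (hInt : Interiority S)
    (hEM : ExpectationMonotone S) (hAn : Anonymity S) :
    ∃ lam : ℝ, 0 ≤ lam ∧ ∀ G, ∀ p ∈ S G, IsLQRE lam G p := by
  choose q hq using fun d => (hS (bonusGame N d)).1
  let f : Fin N → ℝ → ℝ := fun i d =>
    Real.log (q d i (true : Bool)) - Real.log (q d i (false : Bool))
  have hpay : ∀ d i (b : Bool), expPay _ (q d) i b = if b then d else 0 :=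
    fun d i b => expPay_bonusGame ((hS _).2 _ (hq d)) i b
  have hf : ∀ (G : Game N) (p : Profile G), p ∈ S G → ∀ i (a b : G.A i),
      Real.log (p i a) - Real.log (p i b) = f i (expPay G p i a - expPay G p i b) := by
    intro G p hp i a b
    refine log_ratio_eq hS hBr hEN hInt hp (hq _) i a b true false ?_
    rw [hpay, hpay]
    simp
  have hadd : ∀ i x y, f i (x + y) = f i x + f i y := by
    intro i x y
    have hm := fun d => (hS _).2 _ (hq d)
    have hpay₂ : ∀ b : Bool, expPay ((bonusGame N x).comp (bonusGame N y))
        (prodProfile (q x) (q y)) i ((b, b) : Bool × Bool) = if b then x + y else 0 := by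
      intro b
      refine (expPay_comp (hm x) (hm y) i b b).trans ?_
      rw [hpay, hpay]
      cases b <;> simp
    have h := hf _ _ (hBr _ _ _ _ (hq x) (hq y)) i ((true, true) : Bool × Bool)
      ((false, false) : Bool × Bool)
    have hlog : ∀ b : Bool, Real.log (prodProfile (q x) (q y) i ((b, b) : Bool × Bool)) =
        Real.log (q x i b) + Real.log (q y i b) := fun b =>
      Real.log_mul (hInt _ _ (hq x) i b).ne' (hInt _ _ (hq y) i b).ne'
    rw [hpay₂, hpay₂, hlog, hlog] at h
    simp only [if_true, Bool.false_eq_true, if_false, sub_zero] at h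
    rw [← h]
    simp only [f]
    ring
  have hpos : ∀ i x, 0 < x → 0 ≤ f i x := by
    intro i x hx
    refine sub_nonneg.2 (Real.log_le_log (hInt _ _ (hq x) i _)
      (hEM _ _ (hq x) i (true : Bool) (false : Bool) ?_))
    rw [hpay, hpay]
    simpa using hx
  have hlin : ∀ i x, f i x = f i 1 * x := fun i =>
    eq_mul_of_additive_of_nonneg (f i) (hadd i) (hpos i)
  have hsymm : ∀ i j, f i 1 = f j 1 := by
    intro i j
    have hmem := bonusGame_perm_mem hAn (hq 1) (Equiv.swap i j)
    have hm := (hS _).2 _ hmem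
    have hval : ∀ k, k = i →
        Real.log (q 1 k (true : Bool)) - Real.log (q 1 k (false : Bool)) = f i 1 := by
      rintro k rfl
      rfl
    have h := hf _ _ hmem j (true : Bool) (false : Bool)
    rw [expPay_bonusGame hm, expPay_bonusGame hm, hval _ (Equiv.swap_apply_right i j)] at h
    simpa using h
  let i₀ : Fin N := ⟨0, by omega⟩
  refine ⟨f i₀ 1, hpos i₀ 1 one_pos, fun G p hp i a => ?_⟩
  refine eq_exp_div_sum (e := fun b => f i₀ 1 * expPay G p i b) (hInt G p hp i)
    ((hS G).2 p hp i).2 (fun a b => ?_) a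
  rw [hf G p hp, hlin, hsymm i i₀, mul_sub]

end Paper
end
end

section
/- Let S be a solution concept that permits bracketing and satisfies distribution-monotonicity, and assume that in every solution of every game no player plays a strictly dominated action with positive probability (i.e., for every game G=(A,u), every p∈S(G), every player i and every strictly dominated action a_i∈A_i, p_i(a_i)=0). Then S is a refinement of FOSD-Nash, i.e., for every game G every p∈S(G) is an FOSD-Nash. -/
open Filter Topology MeasureTheory

noncomputable section

namespace Paper

section Polya

open Polynomial

/-- All coefficients of `P` are nonnegative. -/
def CoeffNonneg (P : ℝ[X]) : Prop := ∀ k, 0 ≤ P.coeff k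

lemma CoeffNonneg.mul {P Q : ℝ[X]} (hP : CoeffNonneg P) (hQ : CoeffNonneg Q) :
    CoeffNonneg (P * Q) := fun k => by
  rw [coeff_mul]
  exact Finset.sum_nonneg fun x _ => mul_nonneg (hP _) (hQ _)

lemma coeffNonneg_C_add_C_mul_X {a b : ℝ} (ha : 0 ≤ a) (hb : 0 ≤ b) :
    CoeffNonneg (C a + C b * X) := fun k => by
  rcases k with _ | _ | k <;> simp [coeff_X, coeff_C, ha, hb]

lemma CoeffNonneg.pow {P : ℝ[X]} (hP : CoeffNonneg P) (n : ℕ) : CoeffNonneg (P ^ n) := by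
  induction n with
  | zero => exact fun k => by rw [pow_zero, coeff_one]; split_ifs <;> norm_num
  | succ n ih => rw [pow_succ]; exact ih.mul hP

lemma CoeffNonneg.eval_nonneg {P : ℝ[X]} (hP : CoeffNonneg P) {x : ℝ} (hx : 0 ≤ x) :
    0 ≤ P.eval x := by
  rw [eval_eq_sum_range]
  exact Finset.sum_nonneg fun k _ => mul_nonneg (hP k) (pow_nonneg hx k)

/-- A positive definite quadratic is nonnegative even after lower order corrections, once the
total size of its arguments is large. -/
lemma quadratic_form_correction {a b c u v : ℝ} (ha : 0 < a) (hc : 0 < c)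
    (hd : b ^ 2 < 4 * a * c) (hu : 0 ≤ u) (hv : 0 ≤ v)
    (huv : 4 * (a - b + c) * (a + c) ≤ (4 * a * c - b ^ 2) * (u + v)) :
    0 ≤ a * u ^ 2 + b * u * v + c * v ^ 2 - a * u - c * v := by
  have he : 0 < a - b + c := by nlinarith [sq_nonneg (a - c)]
  have h1 : 4 * (a - b + c) * (a * u ^ 2 + b * u * v + c * v ^ 2) =
      (4 * a * c - b ^ 2) * (u + v) ^ 2 +
        (2 * (a - b + c) * u + (b - 2 * c) * (u + v)) ^ 2 := by ring
  have h2 : 4 * (a - b + c) * (a * u + c * v) ≤ 4 * (a - b + c) * ((a + c) * (u + v)) := by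
    apply mul_le_mul_of_nonneg_left _ (by positivity)
    nlinarith [mul_nonneg ha.le hv, mul_nonneg hc.le hu]
  have h3 : 4 * (a - b + c) * (a + c) * (u + v) ≤
      (4 * a * c - b ^ 2) * (u + v) * (u + v) :=
    mul_le_mul_of_nonneg_right huv (by positivity)
  have h4 : 0 ≤ 4 * (a - b + c) *
      (a * u ^ 2 + b * u * v + c * v ^ 2 - a * u - c * v) := by
    nlinarith [sq_nonneg (2 * (a - b + c) * u + (b - 2 * c) * (u + v))]
  exact nonneg_of_mul_nonneg_right h4 (by positivity)

lemma cast_choose_succ_mul (N k : ℕ) (hk : k ≤ N) :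
    (N.choose (k + 1) : ℝ) * (k + 1) = N.choose k * ((N : ℝ) - k) := by
  have := Nat.choose_succ_right_eq N k
  have h : (N.choose (k + 1) : ℝ) * ((k + 1 : ℕ) : ℝ) = N.choose k * ((N - k : ℕ) : ℝ) := by
    exact_mod_cast this
  rw [Nat.cast_sub hk] at h
  push_cast at h
  exact h

lemma exists_coeffNonneg_quadratic {a b c : ℝ} (ha : 0 < a) (hd : b ^ 2 < 4 * a * c) :
    ∃ N : ℕ, CoeffNonneg ((1 + X) ^ N * (C a * X ^ 2 + C b * X + C c)) := by
  have hc : 0 < c := by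
    by_contra! h
    nlinarith [sq_nonneg b, mul_nonneg ha.le (neg_nonneg.2 h)]
  have hD : 0 < 4 * a * c - b ^ 2 := by linarith
  obtain ⟨N, hN⟩ := exists_nat_ge
    (4 * (a - b + c) * (a + c) / (4 * a * c - b ^ 2) + |b| / c)
  refine ⟨N, fun k => ?_⟩
  have hexp : (1 + X : ℝ[X]) ^ N * (C a * X ^ 2 + C b * X + C c) =
      C a * ((1 + X) ^ N * X ^ 2) + C b * ((1 + X) ^ N * X) + C c * (1 + X) ^ N := by ring
  rw [hexp]
  have he : 0 < a - b + c := by nlinarith [sq_nonneg (a - c)]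
  have hq : 0 ≤ 4 * (a - b + c) * (a + c) / (4 * a * c - b ^ 2) := by positivity
  have hq' : 0 ≤ |b| / c := by positivity
  rcases k with _ | _ | k
  · simp [coeff_one_add_X_pow, coeff_X_pow, hc.le]
  · have : |b| ≤ c * N := by
      have := (div_le_iff₀ hc).1 (show |b| / c ≤ N by linarith)
      linarith
    simp [coeff_one_add_X_pow, coeff_mul_X_pow', coeff_mul_X]
    linarith [neg_abs_le b]
  · simp only [coeff_add, coeff_C_mul, coeff_mul_X_pow, coeff_one_add_X_pow]
    rw [show k + 1 + 1 = (k + 1) + 1 from rfl, coeff_mul_X, coeff_one_add_X_pow]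
    rcases le_or_gt k N with hk | hk
    · have h1 := cast_choose_succ_mul N k hk
      have h2 : (N.choose (k + 1 + 1) : ℝ) * (k + 1 + 1) =
          N.choose (k + 1) * ((N : ℝ) - k - 1) := by
        rcases hk.lt_or_eq with hk | rfl
        · have := cast_choose_succ_mul N (k + 1) hk
          push_cast at this
          rw [this]; ring
        · simp [Nat.choose_eq_zero_of_lt (show k < k + 1 + 1 by omega)]
      have hkN : (k : ℝ) ≤ N := by exact_mod_cast hk
      have h3 := quadratic_form_correction (u := k + 2) (v := N - k) ha hc hd
        (by positivity) (by linarith) (by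
          have := (div_le_iff₀ hD).1
            (show 4 * (a - b + c) * (a + c) / (4 * a * c - b ^ 2) ≤ N + 2 by linarith)
          linarith)
      have h4 : (a * N.choose k + b * N.choose (k + 1) + c * N.choose (k + 1 + 1)) *
          (((k : ℝ) + 1) * (k + 1 + 1)) = N.choose k *
          (a * ((k : ℝ) + 2) ^ 2 + b * (k + 2) * (N - k) + c * (N - k) ^ 2 -
            a * (k + 2) - c * (N - k)) := by
        linear_combination (b * ((k : ℝ) + 2) + c * ((N : ℝ) - k - 1)) * h1 +
          c * ((k : ℝ) + 1) * h2
      exact nonneg_of_mul_nonneg_left (h4 ▸ mul_nonneg (by positivity) h3) (by positivity)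
    · rw [Nat.choose_eq_zero_of_lt hk, Nat.choose_eq_zero_of_lt (by omega),
        Nat.choose_eq_zero_of_lt (by omega)]
      simp

lemma exists_coeffNonneg_irreducible {i : ℝ[X]} (hi : Irreducible i)
    (hpos : ∀ x : ℝ, 0 < x → i.eval x ≠ 0) :
    ∃ N : ℕ, CoeffNonneg ((1 + X) ^ N * i) ∨ CoeffNonneg ((1 + X) ^ N * -i) := by
  obtain ⟨a, b, c, rfl⟩ : ∃ a b c : ℝ, i = C a * X ^ 2 + C b * X + C c :=
    ⟨_, _, _, eq_quadratic_of_degree_le_two hi.degree_le_two⟩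
  have hev : ∀ x : ℝ, (C a * X ^ 2 + C b * X + C c : ℝ[X]).eval x = a * x ^ 2 + b * x + c :=
    fun x => by simp
  simp only [hev] at hpos
  by_cases ha : a = 0
  · subst ha
    refine ⟨0, ?_⟩
    have key : ∀ b c : ℝ, 0 ≤ b → 0 ≤ c → CoeffNonneg (C b * X + C c) := fun b c hb hc => by
      rw [add_comm]; exact coeffNonneg_C_add_C_mul_X hc hb
    have hneg : -(C b * X + C c : ℝ[X]) = C (-b) * X + C (-c) := by simp; ring
    simp only [C_0, zero_mul, zero_add, pow_zero, one_mul]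
    rw [hneg]
    rcases lt_trichotomy b 0 with hb | rfl | hb
    · right
      refine key _ _ (by linarith) ?_
      by_contra! h
      exact hpos (c / (-b)) (div_pos (by linarith) (by linarith)) (by
        have := hb.ne
        field_simp; ring)
    · rcases le_total 0 c with hc | hc
      · exact Or.inl (key _ _ le_rfl hc)
      · exact Or.inr (key _ _ (by simp) (by linarith))
    · left
      refine key _ _ hb.le ?_
      by_contra! h
      exact hpos (-c / b) (div_pos (by linarith) hb) (by field_simp; ring)
  · have hdisc : b ^ 2 < 4 * a * c := by
      by_contra! h
      have hroot : (C a * X ^ 2 + C b * X + C c : ℝ[X]).IsRoot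
          ((-b + √(b ^ 2 - 4 * a * c)) / (2 * a)) := by
        rw [IsRoot, hev]
        have := Real.sq_sqrt (show 0 ≤ b ^ 2 - 4 * a * c by linarith)
        generalize √(b ^ 2 - 4 * a * c) = s at this
        field_simp
        linear_combination this
      have := degree_eq_one_of_irreducible_of_root hi hroot
      rw [degree_quadratic ha] at this
      norm_num at this
    rcases lt_or_gt_of_ne ha with ha | ha
    · obtain ⟨N, hN⟩ := exists_coeffNonneg_quadratic (a := -a) (b := -b) (c := -c)
        (by linarith) (by linarith)
      refine ⟨N, Or.inr ?_⟩
      convert hN using 2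
      simp only [C_neg]; ring
    · obtain ⟨N, hN⟩ := exists_coeffNonneg_quadratic ha hdisc
      exact ⟨N, Or.inl hN⟩

/-- Pólya's theorem in one variable, up to sign. -/
lemma exists_coeffNonneg_or_neg {P : ℝ[X]} (hpos : ∀ x : ℝ, 0 < x → P.eval x ≠ 0) :
    ∃ N : ℕ, CoeffNonneg ((1 + X) ^ N * P) ∨ CoeffNonneg ((1 + X) ^ N * -P) := by
  induction P using WfDvdMonoid.induction_on_irreducible with
  | zero => exact absurd (by simp) (hpos 1 one_pos)
  | unit u hu =>
    obtain ⟨r, -, rfl⟩ := isUnit_iff.1 hu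
    refine ⟨0, ?_⟩
    rcases le_total 0 r with hr | hr
    · left; intro k; simp only [pow_zero, one_mul, coeff_C]; split_ifs <;> simp [hr]
    · right; intro k; simp only [pow_zero, one_mul, coeff_C, coeff_neg]; split_ifs <;> simp [hr]
  | mul a i ha hi ih =>
    obtain ⟨N, hN⟩ := ih fun x hx h => hpos x hx (by simp [h])
    obtain ⟨M, hM⟩ := exists_coeffNonneg_irreducible hi fun x hx h => hpos x hx (by simp [h])
    refine ⟨M + N, ?_⟩
    rcases hM with hM | hM <;> rcases hN with hN | hN
    · left; convert hM.mul hN using 1; ring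
    · right; convert hM.mul hN using 1; ring
    · right; convert hM.mul hN using 1; ring
    · left; convert hM.mul hN using 1; ring

/-- A polynomial that is positive on the positive half-line acquires nonnegative coefficients
after multiplication by a high power of any linear polynomial with positive coefficients. -/
lemma exists_coeffNonneg_of_eval_pos {P : ℝ[X]} (hpos : ∀ x : ℝ, 0 < x → 0 < P.eval x)
    {α β : ℝ} (hα : 0 < α) (hβ : 0 < β) :
    ∃ N : ℕ, CoeffNonneg ((C α + C β * X) ^ (N + 1) * P) := by
  have hr : 0 < α / β := div_pos hα hβ
  obtain ⟨N, hN⟩ := exists_coeffNonneg_or_neg (P := P.comp (C (α / β) * X)) fun x hx => by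
    simpa using (hpos _ (mul_pos hr hx)).ne'
  have hN' : CoeffNonneg ((1 + X) ^ N * P.comp (C (α / β) * X)) := by
    refine hN.resolve_right fun h => ?_
    have h1 := h.eval_nonneg zero_le_one
    have h2 := hpos (α / β) hr
    simp only [eval_mul, eval_pow, eval_add, eval_one, eval_X, eval_neg, eval_comp, eval_C,
      mul_one] at h1
    have : (0 : ℝ) < (1 + 1) ^ N := by positivity
    nlinarith [mul_pos this h2]
  have hN'' : CoeffNonneg (C (α ^ N) *
      ((1 + X) ^ N * P.comp (C (α / β) * X)).comp (C (β / α) * X)) := fun k => by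
    rw [coeff_C_mul, comp_C_mul_X_coeff]
    exact mul_nonneg (by positivity) (mul_nonneg (hN' k) (by positivity))
  refine ⟨N, ?_⟩
  rw [pow_succ', mul_assoc]
  refine (coeffNonneg_C_add_C_mul_X hα.le hβ.le).mul ?_
  convert hN'' using 1
  rw [mul_comp, pow_comp, comp_assoc, C_pow, ← mul_assoc, ← mul_pow]
  have h1 : (C (α / β) * X : ℝ[X]).comp (C (β / α) * X) = X := by
    rw [mul_comp, C_comp, X_comp, ← mul_assoc, ← C_mul]
    have : α / β * (β / α) = 1 := by field_simp
    rw [this, C_1, one_mul]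
  have h2 : C α * (1 + X : ℝ[X]).comp (C (β / α) * X) = C α + C β * X := by
    rw [add_comp, X_comp, one_comp, mul_add, mul_one, ← mul_assoc, ← C_mul]
    have : α * (β / α) = β := by field_simp
    rw [this]
  rw [h1, h2, comp_X]

end Polya

section Lotteries

open AddMonoidAlgebra

/-- The expectation of `φ` under the finitely supported signed lottery `μ`. -/
def expect (φ : ℝ → ℝ) : AddMonoidAlgebra ℝ ℝ →ₗ[ℝ] ℝ :=
  Finsupp.linearCombination ℝ φ ∘ₗ (coeffLinearEquiv ℝ).toLinearMap

lemma expect_eq_sum (φ : ℝ → ℝ) (μ : AddMonoidAlgebra ℝ ℝ) {T : Finset ℝ}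
    (hT : μ.coeff.support ⊆ T) : expect φ μ = ∑ r ∈ T, μ.coeff r * φ r :=
  Finsupp.sum_of_support_subset _ hT _ fun _ _ => by simp

@[simp]
lemma expect_single (φ : ℝ → ℝ) (r w : ℝ) : expect φ (single r w) = w * φ r := by
  simp [expect, coeffLinearEquiv]

lemma expect_add_fun (φ ψ : ℝ → ℝ) (μ : AddMonoidAlgebra ℝ ℝ) :
    expect (fun r => φ r + ψ r) μ = expect φ μ + expect ψ μ := by
  simp only [expect_eq_sum _ μ Finset.Subset.rfl, mul_add, Finset.sum_add_distrib]

lemma expect_const_mul (c : ℝ) (φ : ℝ → ℝ) (μ : AddMonoidAlgebra ℝ ℝ) :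
    expect (fun r => c * φ r) μ = c * expect φ μ := by
  simp only [expect_eq_sum _ μ Finset.Subset.rfl, Finset.mul_sum]
  exact Finset.sum_congr rfl fun _ _ => by ring

lemma expect_mul (φ : ℝ → ℝ) (μ ν : AddMonoidAlgebra ℝ ℝ) :
    expect φ (μ * ν) = expect (fun r => expect (fun s => φ (r + s)) ν) μ := by
  induction μ using induction_linear with
  | zero => simp
  | add μ μ' h h' => rw [add_mul, map_add, h, h', map_add]
  | single r w =>
    induction ν using induction_linear with
    | zero => simp
    | add ν ν' h h' =>
      rw [mul_add, map_add, h, h']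
      simp only [expect_single, map_add, mul_add]
    | single s v => simp only [single_mul_single, expect_single]; ring

/-- The signed lottery `μ` is nonnegative and supported in `s`. -/
def ConcentratedOn (s : Set ℝ) (μ : AddMonoidAlgebra ℝ ℝ) : Prop :=
  ∀ φ : ℝ → ℝ, (∀ r ∈ s, 0 ≤ φ r) → 0 ≤ expect φ μ

lemma ConcentratedOn.mono {s t : Set ℝ} (hst : s ⊆ t) {μ : AddMonoidAlgebra ℝ ℝ}
    (h : ConcentratedOn s μ) : ConcentratedOn t μ :=
  fun φ hφ => h φ fun r hr => hφ r (hst hr)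

lemma ConcentratedOn.mul {s t u : Set ℝ} (hstu : ∀ r ∈ s, ∀ r' ∈ t, r + r' ∈ u)
    {μ ν : AddMonoidAlgebra ℝ ℝ} (hμ : ConcentratedOn s μ) (hν : ConcentratedOn t ν) :
    ConcentratedOn u (μ * ν) := fun φ hφ => by
  rw [expect_mul]
  exact hμ _ fun r hr => hν _ fun r' hr' => hφ _ (hstu r hr r' hr')

lemma ConcentratedOn.add {s : Set ℝ} {μ ν : AddMonoidAlgebra ℝ ℝ}
    (hμ : ConcentratedOn s μ) (hν : ConcentratedOn s ν) : ConcentratedOn s (μ + ν) :=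
  fun φ hφ => by rw [map_add]; exact add_nonneg (hμ φ hφ) (hν φ hφ)

lemma concentratedOn_single {s : Set ℝ} {r w : ℝ} (hr : r ∈ s) (hw : 0 ≤ w) :
    ConcentratedOn s (single r w) :=
  fun φ hφ => by rw [expect_single]; exact mul_nonneg hw (hφ r hr)

lemma ConcentratedOn.pow_Ici {μ : AddMonoidAlgebra ℝ ℝ}
    (hμ : ConcentratedOn (Set.Ici 0) μ) (n : ℕ) : ConcentratedOn (Set.Ici 0) (μ ^ n) := by
  induction n with
  | zero => exact concentratedOn_single (by simp) zero_le_one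
  | succ n ih =>
    rw [pow_succ]
    exact ih.mul (fun r hr r' hr' => add_nonneg (Set.mem_Ici.1 hr) (Set.mem_Ici.1 hr')) hμ

lemma ConcentratedOn.expect_le {s : Set ℝ} {μ : AddMonoidAlgebra ℝ ℝ}
    (hμ : ConcentratedOn s μ) {φ ψ : ℝ → ℝ} (h : ∀ r ∈ s, φ r ≤ ψ r) :
    expect φ μ ≤ expect ψ μ := by
  have h1 := hμ (fun r => ψ r + (-1) * φ r) fun r hr => by linarith [h r hr]
  rw [expect_add_fun, expect_const_mul] at h1
  linarith

lemma ConcentratedOn.coeff_eq_zero {s : Set ℝ} {μ : AddMonoidAlgebra ℝ ℝ}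
    (hμ : ConcentratedOn s μ) {r : ℝ} (hr : r ∉ s) : μ.coeff r = 0 := by
  classical
  have h : expect (fun x => if x = r then 1 else 0) μ = μ.coeff r := by
    rw [expect_eq_sum _ μ Finset.Subset.rfl]
    simp [eq_comm]
  have h0 : ∀ x ∈ s, (if x = r then (1 : ℝ) else 0) = 0 := fun x hx =>
    if_neg fun e : x = r => hr (e ▸ hx)
  have h1 := hμ.expect_le (φ := fun x => if x = r then 1 else 0) (ψ := fun _ => 0 * 0)
    fun x hx => by rw [h0 x hx, zero_mul]
  have h2 := hμ.expect_le (ψ := fun x => if x = r then 1 else 0) (φ := fun _ => 0 * 0)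
    fun x hx => by rw [h0 x hx, zero_mul]
  rw [expect_const_mul, zero_mul] at h1 h2
  linarith

lemma expect_mul_of_map_add {φ : ℝ → ℝ} (hφ : ∀ r s, φ (r + s) = φ r * φ s)
    (μ ν : AddMonoidAlgebra ℝ ℝ) : expect φ (μ * ν) = expect φ μ * expect φ ν := by
  rw [expect_mul]
  simp only [hφ, expect_const_mul]
  rw [mul_comm, ← expect_const_mul]
  exact congrArg (fun ψ => expect ψ μ) (funext fun r => mul_comm _ _)

lemma expect_pow_of_map_add {φ : ℝ → ℝ} (hφ : ∀ r s, φ (r + s) = φ r * φ s) (h0 : φ 0 = 1)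
    (μ : AddMonoidAlgebra ℝ ℝ) (n : ℕ) : expect φ (μ ^ n) = expect φ μ ^ n := by
  induction n with
  | zero => simp [one_def, h0]
  | succ n ih => rw [pow_succ, pow_succ, expect_mul_of_map_add hφ, ih]

/-- The total mass of `μ`. -/
abbrev mass (μ : AddMonoidAlgebra ℝ ℝ) : ℝ := expect (fun _ => 1) μ

lemma mass_mul (μ ν : AddMonoidAlgebra ℝ ℝ) : mass (μ * ν) = mass μ * mass ν :=
  expect_mul_of_map_add (fun _ _ => (one_mul 1).symm) μ ν

lemma mass_pow (μ : AddMonoidAlgebra ℝ ℝ) (n : ℕ) : mass (μ ^ n) = mass μ ^ n :=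
  expect_pow_of_map_add (fun _ _ => (one_mul 1).symm) rfl μ n

lemma expect_const (c : ℝ) (μ : AddMonoidAlgebra ℝ ℝ) :
    expect (fun _ => c) μ = c * mass μ := by
  rw [← expect_const_mul, mul_one]

/-- The mean of `μ`. -/
abbrev mean (μ : AddMonoidAlgebra ℝ ℝ) : ℝ := expect (fun r => r) μ

lemma mean_mul {μ ν : AddMonoidAlgebra ℝ ℝ} (hμ : mass μ = 1) (hν : mass ν = 1) :
    mean (μ * ν) = mean μ + mean ν := by
  have h : (fun r => expect (fun s => r + s) ν) = fun r => r + mean ν := funext fun r => by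
    rw [expect_add_fun (fun _ => r), expect_const, hν, mul_one]
  rw [mean, expect_mul, h, expect_add_fun, expect_const, hμ, mul_one]

lemma mean_pow {μ : AddMonoidAlgebra ℝ ℝ} (hμ : mass μ = 1) (n : ℕ) :
    mean (μ ^ n) = n * mean μ := by
  induction n with
  | zero => simp [one_def]
  | succ n ih =>
    rw [pow_succ, mean_mul (by rw [mass_pow, hμ, one_pow]) hμ, ih]
    push_cast; ring

/-- The indicator function of the half-line `(-∞, t]`. -/
def step (t r : ℝ) : ℝ := if r ≤ t then 1 else 0

lemma step_add (t r s : ℝ) : step t (r + s) = step (t - s) r := by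
  simp only [step, le_sub_iff_add_le]

lemma step_antitone {t r s : ℝ} (h : r ≤ s) : step t s ≤ step t r := by
  unfold step; split_ifs <;> linarith

/-- `ν` weakly first-order stochastically dominates `μ`. -/
def DomLe (μ ν : AddMonoidAlgebra ℝ ℝ) : Prop := ∀ t, expect (step t) ν ≤ expect (step t) μ

lemma DomLe.trans {μ ν κ : AddMonoidAlgebra ℝ ℝ} (h : DomLe μ ν) (h' : DomLe ν κ) :
    DomLe μ κ := fun t => (h' t).trans (h t)

lemma DomLe.mul_right {μ ν κ : AddMonoidAlgebra ℝ ℝ} (h : DomLe μ ν)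
    (hκ : ConcentratedOn Set.univ κ) : DomLe (μ * κ) (ν * κ) := fun t => by
  rw [mul_comm ν, mul_comm μ, expect_mul, expect_mul]
  refine hκ.expect_le fun r _ => ?_
  have : (fun s => step t (r + s)) = step (t - r) := funext fun s => by
    rw [add_comm, step_add]
  rw [this]
  exact h _

lemma cdfOf_coeff (μ : AddMonoidAlgebra ℝ ℝ) (t : ℝ) : cdfOf μ.coeff t = expect (step t) μ := by
  rw [expect_eq_sum _ μ Finset.Subset.rfl, cdfOf, finsum_eq_sum_of_support_subset]
  · exact Finset.sum_congr rfl fun r _ => by simp [step]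
  · intro r hr
    simp only [Function.mem_support] at hr
    simp only [Finset.mem_coe, Finsupp.mem_support_iff]
    exact fun h => hr (by simp [h])

lemma fosdgtF_coeff_iff {μ ν : AddMonoidAlgebra ℝ ℝ} :
    FOSDgtF ν.coeff μ.coeff ↔ DomLe μ ν ∧ ν ≠ μ := by
  simp only [FOSDgtF, FOSDgeF, cdfOf_coeff, DomLe, ne_eq, DFunLike.coe_fn_eq, coeff_inj]

/-- Summation by parts, with the case of equality for strictly monotone `φ`. -/
lemma abel_sum_nonneg (T : Finset ℝ) {d : ℝ → ℝ}
    (hd : ∀ t, ∑ r ∈ T with r ≤ t, d r ≤ 0) {φ : ℝ → ℝ} (hφ : MonotoneOn φ T) {c : ℝ}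
    (hc : ∀ r ∈ T, φ r ≤ c) :
    0 ≤ ∑ r ∈ T, d r * (φ r - c) ∧
      (StrictMonoOn φ T → (∀ r ∈ T, φ r < c) → ∑ r ∈ T, d r * (φ r - c) = 0 →
        ∀ r ∈ T, d r = 0) := by
  induction T using Finset.induction_on_max generalizing c with
  | empty => simp
  | insert m T hm ih =>
    have hmT : m ∉ T := fun h => lt_irrefl _ (hm m h)
    have hfilter : ∀ t, m ≤ t → (insert m T).filter (· ≤ t) = insert m T := fun t ht =>
      Finset.filter_true_of_mem fun r hr => by
        rcases Finset.mem_insert.1 hr with rfl | hr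
        exacts [ht, (hm r hr).le.trans ht]
    obtain ⟨h1, h1'⟩ := ih (c := φ m) (fun t => by
      rcases lt_or_ge t m with h | h
      · have := hd t
        rwa [Finset.filter_insert, if_neg (not_le.2 h)] at this
      · rcases T.eq_empty_or_nonempty with rfl | hT
        · simp
        · have := hd (T.max' hT)
          rw [Finset.filter_insert, if_neg (not_le.2 (hm _ (T.max'_mem hT))),
            Finset.filter_true_of_mem fun r hr => T.le_max' r hr] at this
          rwa [Finset.filter_true_of_mem fun r hr => (hm r hr).le.trans h])
      (hφ.mono (by simp)) fun r hr => hφ (by simp [hr]) (by simp) (hm r hr).le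
    have h2 := hd m
    rw [hfilter m le_rfl, Finset.sum_insert hmT] at h2
    have h3 : ∑ r ∈ insert m T, d r * (φ r - c) = ∑ r ∈ T, d r * (φ r - φ m) +
        (d m + ∑ r ∈ T, d r) * (φ m - c) := by
      rw [Finset.sum_insert hmT, add_mul, Finset.sum_mul, add_left_comm,
        ← Finset.sum_add_distrib]
      congr 1
      exact Finset.sum_congr rfl fun _ _ => by ring
    have h4 : 0 ≤ (d m + ∑ r ∈ T, d r) * (φ m - c) :=
      mul_nonneg_of_nonpos_of_nonpos h2 (sub_nonpos.2 (hc m (by simp)))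
    rw [h3]
    refine ⟨add_nonneg h1 h4, fun hs hlt h0 => ?_⟩
    have hT := h1' (hs.mono (by simp)) (fun r hr => hs (by simp [hr]) (by simp) (hm r hr))
      (by linarith)
    have h5 : (d m + ∑ r ∈ T, d r) * (φ m - c) = 0 := by linarith
    rw [Finset.sum_eq_zero hT, add_zero, mul_eq_zero] at h5
    have h6 := h5.resolve_right (sub_ne_zero.2 (hlt m (by simp)).ne)
    simpa [h6] using hT

lemma expect_sub_expect (φ : ℝ → ℝ) (μ ν : AddMonoidAlgebra ℝ ℝ) :
    expect φ ν - expect φ μ =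
      ∑ r ∈ μ.coeff.support ∪ ν.coeff.support, (ν.coeff r - μ.coeff r) * φ r := by
  rw [expect_eq_sum φ μ Finset.subset_union_left, expect_eq_sum φ ν Finset.subset_union_right,
    ← Finset.sum_sub_distrib]
  exact Finset.sum_congr rfl fun _ _ => by ring

lemma expect_sub_expect_of_mass_eq {μ ν : AddMonoidAlgebra ℝ ℝ} (hm : mass μ = mass ν)
    (φ : ℝ → ℝ) (c : ℝ) : expect φ ν - expect φ μ =
      ∑ r ∈ μ.coeff.support ∪ ν.coeff.support, (ν.coeff r - μ.coeff r) * (φ r - c) := by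
  rw [← expect_sub_expect (fun r => φ r - c)]
  have h : ∀ κ, expect (fun r => φ r - c) κ = expect φ κ - c * mass κ := fun κ => by
    simp_rw [sub_eq_add_neg]
    rw [expect_add_fun, expect_const, neg_mul]
  rw [h, h, hm]
  ring

lemma DomLe.sum_filter_nonpos {μ ν : AddMonoidAlgebra ℝ ℝ} (h : DomLe μ ν) (t : ℝ) :
    ∑ r ∈ μ.coeff.support ∪ ν.coeff.support with r ≤ t, (ν.coeff r - μ.coeff r) ≤ 0 := by
  have h1 := expect_sub_expect (step t) μ ν
  simp only [step, mul_ite, mul_one, mul_zero] at h1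
  rw [Finset.sum_filter, ← h1]
  exact sub_nonpos.2 (h t)

lemma DomLe.expect_le {μ ν : AddMonoidAlgebra ℝ ℝ} (h : DomLe μ ν) (hm : mass μ = mass ν)
    {s : Set ℝ} (hμ : ConcentratedOn s μ) (hν : ConcentratedOn s ν) {φ : ℝ → ℝ}
    (hφ : MonotoneOn φ s) : expect φ μ ≤ expect φ ν := by
  have hT : ((μ.coeff.support ∪ ν.coeff.support : Finset ℝ) : Set ℝ) ⊆ s := fun r hr => by
    by_contra hrs
    have := hμ.coeff_eq_zero hrs
    have := hν.coeff_eq_zero hrs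
    simp_all
  obtain ⟨c, hc⟩ := ((μ.coeff.support ∪ ν.coeff.support).finite_toSet.image φ).bddAbove
  have h1 := (abel_sum_nonneg _ h.sum_filter_nonpos (hφ.mono hT)
    fun r hr => hc ⟨r, hr, rfl⟩).1
  rw [← expect_sub_expect_of_mass_eq hm] at h1
  linarith

/-- Strict stochastic dominance strictly increases the mean. -/
lemma DomLe.mean_lt {μ ν : AddMonoidAlgebra ℝ ℝ} (h : DomLe μ ν) (hm : mass μ = mass ν)
    (hne : ν ≠ μ) : mean μ < mean ν := by
  obtain ⟨c, hc⟩ := (μ.coeff.support ∪ ν.coeff.support).finite_toSet.bddAbove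
  obtain ⟨h1, h2⟩ := abel_sum_nonneg _ h.sum_filter_nonpos (monotone_id.monotoneOn _)
    (c := c + 1) fun r hr => (hc hr).trans (by linarith)
  replace h2 := h2 (strictMono_id.strictMonoOn _) fun r hr => (hc hr).trans_lt (by linarith)
  rw [← expect_sub_expect_of_mass_eq hm] at h1 h2
  refine (sub_nonneg.1 h1).lt_of_ne fun heq => hne (coeff_inj.1 (Finsupp.ext fun r => ?_))
  by_cases hr : r ∈ μ.coeff.support ∪ ν.coeff.support
  · exact sub_eq_zero.1 (h2 (sub_eq_zero.2 heq.symm) r hr)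
  · simp only [Finset.mem_union, Finsupp.mem_support_iff, not_or, not_not] at hr
    rw [hr.1, hr.2]

end Lotteries

section LatticePolynomials

open AddMonoidAlgebra Polynomial

/-- The polynomial `∑ μ(r) X ^ k r`. -/
def toPoly (k : ℝ → ℕ) : AddMonoidAlgebra ℝ ℝ →ₗ[ℝ] ℝ[X] :=
  Finsupp.linearCombination ℝ (fun r => (X : ℝ[X]) ^ k r) ∘ₗ (coeffLinearEquiv ℝ).toLinearMap

lemma toPoly_single (k : ℝ → ℕ) (r w : ℝ) : toPoly k (single r w) = w • X ^ k r := by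
  simp [toPoly, coeffLinearEquiv]

lemma eval_toPoly (k : ℝ → ℕ) (μ : AddMonoidAlgebra ℝ ℝ) (x : ℝ) :
    (toPoly k μ).eval x = expect (fun r => x ^ k r) μ := by
  induction μ using induction_linear with
  | zero => simp
  | add μ ν h h' => simp [h, h']
  | single r w => simp [toPoly_single]

lemma derivative_toPoly_eval_one (k : ℝ → ℕ) (μ : AddMonoidAlgebra ℝ ℝ) :
    (derivative (toPoly k μ)).eval 1 = expect (fun r => (k r : ℝ)) μ := by
  induction μ using induction_linear with
  | zero => simp
  | add μ ν h h' => simp [h, h']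
  | single r w => simp [toPoly_single, derivative_X_pow]

/-- The signed lottery on `ℕ` with generating polynomial `P`. -/
def ofPoly : ℝ[X] →ₐ[ℝ] AddMonoidAlgebra ℝ ℝ := aeval (single 1 1)

lemma ofPoly_X_pow (n : ℕ) : ofPoly (X ^ n) = single (n : ℝ) 1 := by
  simp [ofPoly, single_pow]

lemma ofPoly_C (w : ℝ) : ofPoly (C w) = single 0 w := by
  simp [ofPoly]

lemma expect_ofPoly_toPoly (k : ℝ → ℕ) (φ : ℝ → ℝ) (μ : AddMonoidAlgebra ℝ ℝ) :
    expect φ (ofPoly (toPoly k μ)) = expect (fun r => φ (k r)) μ := by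
  induction μ using induction_linear with
  | zero => simp
  | add μ ν h h' => simp only [map_add, h, h']
  | single r w => rw [toPoly_single, map_smul, ofPoly_X_pow, map_smul]; simp

lemma CoeffNonneg.concentratedOn_ofPoly {P : ℝ[X]} (hP : CoeffNonneg P) :
    ConcentratedOn Set.univ (ofPoly P) := fun φ hφ => by
  rw [P.as_sum_range_C_mul_X_pow, map_sum, map_sum]
  refine Finset.sum_nonneg fun n _ => ?_
  rw [map_mul, ofPoly_C, ofPoly_X_pow, single_mul_single, expect_single]
  exact mul_nonneg (mul_nonneg (hP n) zero_le_one) (hφ _ trivial)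

lemma domLe_ofPoly {P Q T : ℝ[X]} (hT : CoeffNonneg T) (h : P - Q = (1 - X) * T) :
    DomLe (ofPoly P) (ofPoly Q) := fun t => by
  have h1 : DomLe (1 : AddMonoidAlgebra ℝ ℝ) (single 1 1) := fun t => by
    rw [one_def, expect_single, expect_single, one_mul, one_mul]
    exact step_antitone zero_le_one
  have h2 := h1.mul_right hT.concentratedOn_ofPoly t
  have h3 : ofPoly P - ofPoly Q = 1 * ofPoly T - single 1 1 * ofPoly T := by
    rw [← map_sub, h, map_mul, map_sub, map_one, sub_mul]
    simp [ofPoly]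
  have h4 := congrArg (expect (step t)) h3
  rw [map_sub, map_sub] at h4
  linarith

/-- If `Q` lies below `P` on `(0, 1)`, above it on `(1, ∞)`, and the two cross transversally
at `1`, then enough binomial noise makes `Q` stochastically dominate `P`. -/
lemma exists_domLe_ofPoly_mul_pow {P Q : ℝ[X]} (h1 : P.eval 1 = Q.eval 1)
    (hd : (derivative P).eval 1 < (derivative Q).eval 1)
    (hlt : ∀ x, 0 < x → x < 1 → Q.eval x < P.eval x) (hgt : ∀ x, 1 < x → P.eval x < Q.eval x)
    {α β : ℝ} (hα : 0 < α) (hβ : 0 < β) :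
    ∃ N, DomLe (ofPoly (P * (C α + C β * X) ^ (N + 1)))
      (ofPoly (Q * (C α + C β * X) ^ (N + 1))) := by
  obtain ⟨R, hR⟩ : X - C (1 : ℝ) ∣ Q - P := by
    rw [dvd_iff_isRoot, IsRoot, eval_sub, h1, sub_self]
  have hpos : ∀ x > 0, 0 < R.eval x := fun x hx => by
    have he := congrArg (eval x) hR
    simp only [eval_sub, eval_mul, eval_X, eval_C] at he
    rcases lt_trichotomy x 1 with hx1 | rfl | hx1
    · have := hlt x hx hx1
      by_contra! hn
      nlinarith
    · have := congrArg (fun P => eval 1 (derivative P)) hR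
      simp at this
      linarith
    · have := hgt x hx1
      by_contra! hn
      nlinarith
  obtain ⟨N, hN⟩ := exists_coeffNonneg_of_eval_pos hpos hα hβ
  refine ⟨N, domLe_ofPoly hN ?_⟩
  rw [C_1] at hR
  linear_combination -(C α + C β * X) ^ (N + 1) * hR

end LatticePolynomials

section Domination

open AddMonoidAlgebra Polynomial

lemma expect_rpow_pow (μ : AddMonoidAlgebra ℝ ℝ) {x : ℝ} (hx : 0 < x) (n : ℕ) :
    expect (fun r => x ^ r) (μ ^ n) = expect (fun r => x ^ r) μ ^ n :=
  expect_pow_of_map_add (fun _ _ => Real.rpow_add hx _ _) (Real.rpow_zero x) μ n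

lemma ConcentratedOn.expect_rpow_pos {s : Set ℝ} {μ : AddMonoidAlgebra ℝ ℝ}
    (hμ : ConcentratedOn s μ) {R : ℝ} (hs : s ⊆ Set.Icc 0 R) (hm : mass μ = 1) {x : ℝ}
    (hx : 0 < x) : 0 < expect (fun r => x ^ r) μ := by
  have h : expect (fun _ => min 1 (x ^ R)) μ ≤ expect (fun r => x ^ r) μ :=
    hμ.expect_le fun r hr => by
      obtain ⟨h0, hR⟩ := hs hr
      rcases le_total x 1 with h1 | h1
      · exact (min_le_right _ _).trans (Real.rpow_le_rpow_of_exponent_ge hx h1 hR)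
      · exact (min_le_left _ _).trans (Real.one_le_rpow h1 h0)
  rw [expect_const, hm, mul_one] at h
  exact (lt_min one_pos (Real.rpow_pos_of_pos hx R)).trans_le h

lemma one_add_mul_log_le_rpow {x : ℝ} (hx : 0 < x) (h : ℝ) : 1 + h * Real.log x ≤ x ^ h := by
  rw [Real.rpow_def_of_pos hx, add_comm, mul_comm h]
  exact Real.add_one_le_exp _

variable {μ ν : AddMonoidAlgebra ℝ ℝ} {R : ℝ}

lemma DomLe.expect_rpow_ge_of_lt_one (h : DomLe μ ν) (hμm : mass μ = 1) (hνm : mass ν = 1)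
    (hμ : ConcentratedOn (Set.Icc 0 R) μ) (hν : ConcentratedOn (Set.Icc 0 R) ν)
    {x₀ x : ℝ} (hx₀ : 0 < x₀) (hx₀R : 0 ≤ R) (hx : x₀ ≤ x) (hx1 : x ≤ 1) :
    expect (fun r => x ^ r) ν * (1 + (mean ν - mean μ) * x₀ ^ R * (1 - x)) ≤
      expect (fun r => x ^ r) μ := by
  have hx0 : 0 < x := hx₀.trans_le hx
  have hm : mass μ = mass ν := hμm.trans hνm.symm
  have hδ : mean μ ≤ mean ν := h.expect_le hm hμ hν (monotone_id.monotoneOn _)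
  have hc := Real.rpow_pos_of_pos hx₀ R
  have h1 := h.expect_le hm hμ hν
      (φ := fun r => (-1) * x ^ r + (-(x₀ ^ R * (1 - x))) * r) fun r hr s hs hrs => by
    have e : x ^ r = x ^ s * x ^ (-(s - r)) := by
      rw [← Real.rpow_add hx0]; congr 1; ring
    have h2 := one_add_mul_log_le_rpow hx0 (-(s - r))
    have h3 := Real.log_le_sub_one_of_pos hx0
    have h4 : x₀ ^ R ≤ x ^ s := (Real.rpow_le_rpow hx₀.le hx hx₀R).trans
      (Real.rpow_le_rpow_of_exponent_ge hx0 hx1 hs.2)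
    have h5 : (s - r) * (1 - x) ≤ x ^ (-(s - r)) - 1 := by nlinarith
    have h6 : x₀ ^ R * ((s - r) * (1 - x)) ≤ x ^ s * (x ^ (-(s - r)) - 1) :=
      mul_le_mul h4 h5 (mul_nonneg (by linarith) (by linarith)) (hc.le.trans h4)
    simp only [e]
    linarith
  rw [expect_add_fun, expect_add_fun, expect_const_mul, expect_const_mul, expect_const_mul,
    expect_const_mul] at h1
  have h2 : expect (fun r => x ^ r) ν ≤ 1 := by
    have := hν.expect_le (φ := fun r => x ^ r) (ψ := fun _ => 1) fun r hr =>
      Real.rpow_le_one hx0.le hx1 hr.1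
    exact this.trans_eq hνm
  have h3 : 0 ≤ (mean ν - mean μ) * x₀ ^ R * (1 - x) :=
    mul_nonneg (mul_nonneg (by linarith) hc.le) (by linarith)
  nlinarith

lemma DomLe.expect_rpow_ge_of_one_lt (h : DomLe μ ν) (hμm : mass μ = 1) (hνm : mass ν = 1)
    (hμ : ConcentratedOn (Set.Icc 0 R) μ) (hν : ConcentratedOn (Set.Icc 0 R) ν)
    {x₁ x : ℝ} (hx₁R : 0 ≤ R) (hx1 : 1 ≤ x) (hx : x ≤ x₁) :
    expect (fun r => x ^ r) μ * (1 + (mean ν - mean μ) / (x₁ * x₁ ^ R) * (x - 1)) ≤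
      expect (fun r => x ^ r) ν := by
  have hx0 : 0 < x := one_pos.trans_le hx1
  have hx₁ : 0 < x₁ := hx0.trans_le hx
  have hm : mass μ = mass ν := hμm.trans hνm.symm
  have hδ : mean μ ≤ mean ν := h.expect_le hm hμ hν (monotone_id.monotoneOn _)
  have hc := Real.rpow_pos_of_pos hx₁ R
  have h1 := h.expect_le hm hμ hν
      (φ := fun r => x ^ r + (-(x₁⁻¹ * (x - 1))) * r) fun r hr s hs hrs => by
    have e : x ^ s = x ^ r * x ^ (s - r) := by
      rw [← Real.rpow_add hx0]; congr 1; ring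
    have h2 := one_add_mul_log_le_rpow hx0 (s - r)
    have h3 := Real.one_sub_inv_le_log_of_pos hx0
    have h4 : 1 ≤ x ^ r := Real.one_le_rpow hx1 hr.1
    have h5 : x₁⁻¹ * (x - 1) ≤ 1 - x⁻¹ := by
      have : 1 - x⁻¹ = x⁻¹ * (x - 1) := by field_simp
      rw [this]
      exact mul_le_mul_of_nonneg_right (inv_anti₀ hx0 hx) (by linarith)
    have h6 : (s - r) * (x₁⁻¹ * (x - 1)) ≤ x ^ (s - r) - 1 := by
      have := mul_le_mul_of_nonneg_left (h5.trans h3) (sub_nonneg.2 hrs)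
      linarith
    have h7 : 0 ≤ (s - r) * (x₁⁻¹ * (x - 1)) :=
      mul_nonneg (by linarith) (mul_nonneg (inv_nonneg.2 hx₁.le) (by linarith))
    simp only [e]
    nlinarith
  rw [expect_add_fun, expect_add_fun, expect_const_mul, expect_const_mul] at h1
  have h2 : expect (fun r => x ^ r) μ ≤ x₁ ^ R := by
    have := hμ.expect_le (φ := fun r => x ^ r) (ψ := fun _ => x₁ ^ R) fun r hr =>
      (Real.rpow_le_rpow_of_exponent_le hx1 hr.2).trans (Real.rpow_le_rpow hx0.le hx hx₁R)
    rwa [expect_const, hμm, mul_one] at this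
  have h3 : expect (fun r => x ^ r) μ * ((mean ν - mean μ) / (x₁ * x₁ ^ R) * (x - 1)) ≤
      x₁ ^ R * ((mean ν - mean μ) / (x₁ * x₁ ^ R) * (x - 1)) :=
    mul_le_mul_of_nonneg_right h2 (mul_nonneg (div_nonneg (by linarith) (by positivity))
      (by linarith))
  have h4 : x₁ ^ R * ((mean ν - mean μ) / (x₁ * x₁ ^ R) * (x - 1)) =
      x₁⁻¹ * (x - 1) * (mean ν - mean μ) := by field_simp
  linarith

lemma lt_mul_pow_of_lt_one {a b κ x₀ x : ℝ} (hb : 0 < b) (hκ : 0 ≤ κ) (hx₀ : 0 < x₀)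
    (hx : x₀ ≤ x) (hx1 : x < 1) (h : b * (1 + κ * (1 - x)) ≤ a) {m : ℕ}
    (hm : 4 ≤ m * κ * x₀ ^ 4) : b ^ m < x ^ 4 * a ^ m := by
  have h0 : 0 ≤ κ * (1 - x) := mul_nonneg hκ (by linarith)
  have h1 : b ^ m * (1 + m * (κ * (1 - x))) ≤ a ^ m := by
    refine le_trans ?_ (pow_le_pow_left₀ (by positivity) h m)
    rw [mul_pow]
    exact mul_le_mul_of_nonneg_left (one_add_mul_le_pow (by linarith) m) (by positivity)
  have h2 : x₀ ^ 4 ≤ x ^ 4 := pow_le_pow_left₀ hx₀.le hx 4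
  have h3 : 1 < x ^ 4 * (1 + m * (κ * (1 - x))) := by
    have h4 : 4 * (1 - x) ≤ x ^ 4 * (m * (κ * (1 - x))) := by
      have : 4 ≤ m * κ * x ^ 4 := hm.trans (mul_le_mul_of_nonneg_left h2 (by positivity))
      nlinarith
    have h5 : 1 - 4 * (1 - x) < x ^ 4 := by
      have hx0 : 0 < x := hx₀.trans_le hx
      have : 0 < (1 - x) ^ 2 * (x ^ 2 + 2 * x + 3) := by
        have : 0 < 1 - x := by linarith
        positivity
      nlinarith
    linarith
  calc b ^ m < b ^ m * (x ^ 4 * (1 + m * (κ * (1 - x)))) :=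
        lt_mul_of_one_lt_right (by positivity) h3
    _ = x ^ 4 * (b ^ m * (1 + m * (κ * (1 - x)))) := by ring
    _ ≤ _ := mul_le_mul_of_nonneg_left h1 (by positivity)

lemma mul_pow_lt_of_one_lt {a b κ x₁ x : ℝ} (ha : 0 < a) (hκ : 0 ≤ κ) (hx1 : 1 < x)
    (hx : x ≤ x₁) (h : a * (1 + κ * (x - 1)) ≤ b) {m : ℕ} (hm : 4 * x₁ ^ 3 ≤ m * κ) :
    x ^ 4 * a ^ m < b ^ m := by
  have h0 : 0 ≤ κ * (x - 1) := mul_nonneg hκ (by linarith)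
  have h1 : a ^ m * (1 + m * (κ * (x - 1))) ≤ b ^ m := by
    refine le_trans ?_ (pow_le_pow_left₀ (by positivity) h m)
    rw [mul_pow]
    exact mul_le_mul_of_nonneg_left (one_add_mul_le_pow (by linarith) m) (by positivity)
  have hx0 : 0 < x := by linarith
  have h2 : x ^ 3 ≤ x₁ ^ 3 := pow_le_pow_left₀ hx0.le hx 3
  have h3 : x ^ 4 < 1 + m * (κ * (x - 1)) := by
    have h4 : 4 * x ^ 3 * (x - 1) ≤ m * (κ * (x - 1)) := by
      rw [← mul_assoc]
      exact mul_le_mul_of_nonneg_right (by linarith) (by linarith)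
    have : 0 < (x - 1) ^ 2 * (3 * x ^ 2 + 2 * x + 1) := by
      have : 0 < x - 1 := by linarith
      positivity
    nlinarith
  calc x ^ 4 * a ^ m < (1 + m * (κ * (x - 1))) * a ^ m :=
        mul_lt_mul_of_pos_right h3 (by positivity)
    _ ≤ _ := by rw [mul_comm]; exact h1

/-- The lottery paying `y` with probability `q` and `x` otherwise. -/
def gamble (x y q : ℝ) : AddMonoidAlgebra ℝ ℝ := single x (1 - q) + single y q

lemma expect_gamble (φ : ℝ → ℝ) (x y q : ℝ) :
    expect φ (gamble x y q) = (1 - q) * φ x + q * φ y := by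
  rw [gamble, map_add, expect_single, expect_single]

lemma mass_gamble (x y q : ℝ) : mass (gamble x y q) = 1 := by
  rw [mass, expect_gamble]; ring

lemma ofPoly_C_mul_X_pow_add (q : ℝ) (k l : ℕ) :
    ofPoly (C (1 - q) * X ^ k + C q * X ^ l) = gamble k l q := by
  simp only [map_add, map_mul, ofPoly_C, ofPoly_X_pow, single_mul_single, gamble, zero_add,
    mul_one]

lemma concentratedOn_gamble {x y q : ℝ} (hq : q ∈ Set.Ioo 0 1) :
    ConcentratedOn Set.univ (gamble x y q) :=
  (concentratedOn_single (Set.mem_univ _) (by linarith [hq.2])).add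
    (concentratedOn_single (Set.mem_univ _) hq.1.le)

lemma ConcentratedOn.domLe_ofPoly_ceil {κ : AddMonoidAlgebra ℝ ℝ}
    (hκ : ConcentratedOn (Set.Ici 0) κ) : DomLe κ (ofPoly (toPoly Nat.ceil κ)) := fun t => by
  rw [expect_ofPoly_toPoly]
  exact hκ.expect_le fun r _ => step_antitone (Nat.le_ceil r)

lemma ConcentratedOn.domLe_ofPoly_floor {κ : AddMonoidAlgebra ℝ ℝ}
    (hκ : ConcentratedOn (Set.Ici 0) κ) : DomLe (ofPoly (toPoly Nat.floor κ)) κ := fun t => by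
  rw [expect_ofPoly_toPoly]
  exact hκ.expect_le fun r hr => step_antitone (Nat.floor_le hr)

lemma ConcentratedOn.mul_le_eval_toPoly_ceil {κ : AddMonoidAlgebra ℝ ℝ}
    (hκ : ConcentratedOn (Set.Ici 0) κ) {x : ℝ} (hx : 0 < x) (hx1 : x ≤ 1) :
    x * expect (fun r => x ^ r) κ ≤ (toPoly Nat.ceil κ).eval x := by
  rw [eval_toPoly, ← expect_const_mul]
  refine hκ.expect_le fun r hr => ?_
  rw [← Real.rpow_natCast, ← Real.rpow_one_add' hx.le (by linarith [Set.mem_Ici.1 hr])]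
  exact Real.rpow_le_rpow_of_exponent_ge hx hx1 (by linarith [Nat.ceil_lt_add_one (Set.mem_Ici.1 hr)])

lemma ConcentratedOn.eval_toPoly_ceil_le {κ : AddMonoidAlgebra ℝ ℝ}
    (hκ : ConcentratedOn (Set.Ici 0) κ) {x : ℝ} (hx1 : 1 ≤ x) :
    (toPoly Nat.ceil κ).eval x ≤ x * expect (fun r => x ^ r) κ := by
  rw [eval_toPoly, ← expect_const_mul]
  refine hκ.expect_le fun r hr => ?_
  rw [← Real.rpow_natCast, ← Real.rpow_one_add' (by linarith) (by linarith [Set.mem_Ici.1 hr])]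
  exact Real.rpow_le_rpow_of_exponent_le hx1 (by linarith [Nat.ceil_lt_add_one (Set.mem_Ici.1 hr)])

lemma ConcentratedOn.mul_eval_toPoly_floor_le {κ : AddMonoidAlgebra ℝ ℝ}
    (hκ : ConcentratedOn (Set.Ici 0) κ) {x : ℝ} (hx : 0 < x) (hx1 : x ≤ 1) :
    x * (toPoly Nat.floor κ).eval x ≤ expect (fun r => x ^ r) κ := by
  rw [eval_toPoly, ← expect_const_mul]
  refine hκ.expect_le fun r hr => ?_
  rw [← Real.rpow_natCast, ← Real.rpow_one_add' hx.le (by positivity)]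
  exact Real.rpow_le_rpow_of_exponent_ge hx hx1 (by linarith [Nat.lt_floor_add_one r])

lemma ConcentratedOn.le_mul_eval_toPoly_floor {κ : AddMonoidAlgebra ℝ ℝ}
    (hκ : ConcentratedOn (Set.Ici 0) κ) {x : ℝ} (hx1 : 1 ≤ x) :
    expect (fun r => x ^ r) κ ≤ x * (toPoly Nat.floor κ).eval x := by
  rw [eval_toPoly, ← expect_const_mul]
  refine hκ.expect_le fun r hr => ?_
  rw [← Real.rpow_natCast, ← Real.rpow_one_add' (by linarith) (by positivity)]
  exact Real.rpow_le_rpow_of_exponent_le hx1 (by linarith [Nat.lt_floor_add_one r])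

lemma ConcentratedOn.derivative_toPoly_ceil_le {κ : AddMonoidAlgebra ℝ ℝ}
    (hκ : ConcentratedOn (Set.Ici 0) κ) (hm : mass κ = 1) :
    (derivative (toPoly Nat.ceil κ)).eval 1 ≤ mean κ + 1 := by
  rw [derivative_toPoly_eval_one]
  have := hκ.expect_le (φ := fun r => (⌈r⌉₊ : ℝ)) (ψ := fun r => r + 1) fun r hr =>
    (Nat.ceil_lt_add_one hr).le
  rwa [expect_add_fun, expect_const, hm, one_mul] at this

lemma ConcentratedOn.le_derivative_toPoly_floor {κ : AddMonoidAlgebra ℝ ℝ}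
    (hκ : ConcentratedOn (Set.Ici 0) κ) (hm : mass κ = 1) :
    mean κ ≤ (derivative (toPoly Nat.floor κ)).eval 1 + 1 := by
  rw [derivative_toPoly_eval_one]
  have := hκ.expect_le (ψ := fun r => (⌊r⌋₊ : ℝ) + 1) (φ := fun r => r) fun r hr =>
    (Nat.lt_floor_add_one r).le
  rwa [expect_add_fun, expect_const, hm, one_mul] at this

lemma mul_eval_lt_of_lt_one {q₁ q₂ x a b A B : ℝ} (h₁ : q₁ ∈ Set.Ioo 0 1)
    (h₂ : q₂ ∈ Set.Ioo 0 1) (hx : 0 < x) (hx1 : x < 1) (ha : 0 < a) (hba : b ≤ a)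
    (hA : x * a ≤ A) (hB : x * B ≤ b) (h : 1 - q₁ ≤ x → b < x ^ 4 * a) :
    B * ((1 - q₂) * x ^ 3 + q₂ * x ^ 8) < A * (1 - q₁ + q₁ * x ^ 5) := by
  obtain ⟨hq₁, hq₁'⟩ := h₁
  obtain ⟨hq₂, hq₂'⟩ := h₂
  replace hq₁' : 0 < 1 - q₁ := sub_pos.2 hq₁'
  replace hq₂' : 0 < 1 - q₂ := sub_pos.2 hq₂'
  have h8 : x ^ 8 ≤ x ^ 3 := pow_le_pow_of_le_one hx.le hx1.le (by norm_num)
  have h5 : x ^ 5 ≤ 1 := pow_le_one₀ hx.le hx1.le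
  set w := 1 - q₁ + q₁ * x ^ 5 with hw
  set w' := (1 - q₂) * x ^ 3 + q₂ * x ^ 8 with hw'
  have hw0 : 0 < w := by positivity
  have hw0' : 0 < w' := by positivity
  have hw3 : w' ≤ x ^ 3 := by
    have := mul_le_mul_of_nonneg_left h8 hq₂.le
    linarith
  have hw5 : x ^ 5 ≤ w := by
    have := mul_le_mul_of_nonneg_left h5 hq₁'.le
    linarith
  have hA0 : 0 < A := (mul_pos hx ha).trans_le hA
  rcases le_or_gt B 0 with hB0 | hB0
  · exact (mul_nonpos_of_nonpos_of_nonneg hB0 hw0'.le).trans_lt (mul_pos hA0 hw0)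
  have hb : 0 < b := (mul_pos hx hB0).trans_le hB
  have key : b * x < a * w := by
    rcases lt_or_ge x (1 - q₁) with hxx | hxx
    · have : x < w := by
        have : 0 < q₁ * x ^ 5 := by positivity
        linarith
      calc b * x ≤ a * x := by gcongr
        _ < _ := by gcongr
    · calc b * x < x ^ 4 * a * x := by gcongr; exact h hxx
        _ = a * x ^ 5 := by ring
        _ ≤ _ := by gcongr
  refine lt_of_mul_lt_mul_left ?_ hx.le
  calc x * (B * w') = x * B * w' := by ring
    _ ≤ b * x ^ 3 := by gcongr
    _ = x ^ 2 * (b * x) := by ring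
    _ < x ^ 2 * (a * w) := by gcongr
    _ = x * (x * a * w) := by ring
    _ ≤ _ := by gcongr

lemma mul_eval_lt_of_one_lt {q₁ q₂ x a b A B : ℝ} (h₁ : q₁ ∈ Set.Ioo 0 1)
    (h₂ : q₂ ∈ Set.Ioo 0 1) (hx1 : 1 < x) (ha : 0 < a) (hab : a ≤ b)
    (hA : A ≤ x * a) (hB : b ≤ x * B) (h : x ≤ q₂⁻¹ → x ^ 4 * a < b) :
    A * (1 - q₁ + q₁ * x ^ 5) < B * ((1 - q₂) * x ^ 3 + q₂ * x ^ 8) := by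
  obtain ⟨hq₁, hq₁'⟩ := h₁
  obtain ⟨hq₂, hq₂'⟩ := h₂
  replace hq₁' : 0 < 1 - q₁ := sub_pos.2 hq₁'
  replace hq₂' : 0 < 1 - q₂ := sub_pos.2 hq₂'
  have hx : 0 < x := one_pos.trans hx1
  have hb : 0 < b := ha.trans_le hab
  have h8 : x ^ 3 ≤ x ^ 8 := pow_le_pow_right₀ hx1.le (by norm_num)
  have h5 : 1 ≤ x ^ 5 := one_le_pow₀ hx1.le
  set w := 1 - q₁ + q₁ * x ^ 5 with hw
  set w' := (1 - q₂) * x ^ 3 + q₂ * x ^ 8 with hw'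
  have hw0 : 0 < w := by positivity
  have hw0' : 0 < w' := by positivity
  have hw5 : w ≤ x ^ 5 := by
    have := mul_le_mul_of_nonneg_left h5 hq₁'.le
    linarith
  have key : x ^ 2 * (a * w) < b * w' := by
    rcases lt_or_ge q₂⁻¹ x with hxx | hxx
    · have h7 : x ^ 7 < w' := by
        rw [inv_lt_iff_one_lt_mul₀' hq₂] at hxx
        have h2 : 0 < (1 - q₂) * x ^ 3 := by positivity
        have h3 : 1 * x ^ 7 < q₂ * x * x ^ 7 := by gcongr
        have h4 : q₂ * x * x ^ 7 = q₂ * x ^ 8 := by ring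
        linarith
      calc x ^ 2 * (a * w) ≤ x ^ 2 * (b * x ^ 5) := by gcongr
        _ = b * x ^ 7 := by ring
        _ < _ := by gcongr
    · have h3 : x ^ 3 ≤ w' := by
        have := mul_le_mul_of_nonneg_left h8 hq₂.le
        linarith
      calc x ^ 2 * (a * w) ≤ x ^ 2 * (a * x ^ 5) := by gcongr
        _ = x ^ 4 * a * x ^ 3 := by ring
        _ < b * x ^ 3 := by gcongr; exact h hxx
        _ ≤ _ := by gcongr
  refine lt_of_mul_lt_mul_left ?_ hx.le
  calc x * (A * w) ≤ x * (x * a * w) := by gcongr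
    _ = x ^ 2 * (a * w) := by ring
    _ < b * w' := key
    _ ≤ x * B * w' := by gcongr
    _ = _ := by ring

lemma DomLe.expect_rpow_le_of_le_one (h : DomLe μ ν) (hm : mass μ = mass ν)
    (hμ : ConcentratedOn Set.univ μ) (hν : ConcentratedOn Set.univ ν) {x : ℝ} (hx : 0 < x)
    (hx1 : x ≤ 1) : expect (fun r => x ^ r) ν ≤ expect (fun r => x ^ r) μ := by
  have h1 := h.expect_le hm hμ hν (φ := fun r => (-1) * x ^ r) fun r _ s _ hrs => by
    simpa using Real.rpow_le_rpow_of_exponent_ge hx hx1 hrs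
  rw [expect_const_mul, expect_const_mul] at h1
  linarith

lemma DomLe.expect_rpow_le_of_one_le (h : DomLe μ ν) (hm : mass μ = mass ν)
    (hμ : ConcentratedOn Set.univ μ) (hν : ConcentratedOn Set.univ ν) {x : ℝ}
    (hx1 : 1 ≤ x) : expect (fun r => x ^ r) μ ≤ expect (fun r => x ^ r) ν :=
  h.expect_le hm hμ hν fun _ _ _ _ hrs => Real.rpow_le_rpow_of_exponent_le hx1 hrs

lemma DomLe.exists_domLe_pow_mul_of_Icc (h : DomLe μ ν) (hμm : mass μ = 1) (hνm : mass ν = 1)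
    (hR : 0 ≤ R) (hμ : ConcentratedOn (Set.Icc 0 R) μ) (hν : ConcentratedOn (Set.Icc 0 R) ν)
    (hne : ν ≠ μ) {q₁ q₂ q₃ : ℝ} (h₁ : q₁ ∈ Set.Ioo 0 1) (h₂ : q₂ ∈ Set.Ioo 0 1)
    (h₃ : q₃ ∈ Set.Ioo 0 1) :
    ∃ n N : ℕ, 4 < (n + 1 : ℕ) * (mean ν - mean μ) ∧
      DomLe (μ ^ (n + 1) * gamble 0 5 q₁ * gamble 0 1 q₃ ^ (N + 1))
        (ν ^ (n + 1) * gamble 3 8 q₂ * gamble 0 1 q₃ ^ (N + 1)) := by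
  have ⟨hq₁, hq₁'⟩ := h₁
  have ⟨hq₂, hq₂'⟩ := h₂
  have ⟨hq₃, hq₃'⟩ := h₃
  have hμu := hμ.mono (Set.subset_univ _)
  have hνu := hν.mono (Set.subset_univ _)
  have hm : mass μ = mass ν := hμm.trans hνm.symm
  have hδ : 0 < mean ν - mean μ := sub_pos.2 (h.mean_lt hm hne)
  set δ := mean ν - mean μ with hδ_def
  set x₀ := 1 - q₁ with hx₀_def
  set x₁ := q₂⁻¹ with hx₁_def
  have hx₀ : 0 < x₀ := by linarith
  have hx₁ : 0 < x₁ := inv_pos.2 hq₂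
  have hx₀R := Real.rpow_pos_of_pos hx₀ R
  have hx₁R := Real.rpow_pos_of_pos hx₁ R
  obtain ⟨n, hn⟩ := exists_nat_gt (max (4 / δ)
    (max (4 / (δ * x₀ ^ R * x₀ ^ 4)) (4 * x₁ ^ 3 / (δ / (x₁ * x₁ ^ R)))))
  simp only [max_lt_iff] at hn
  obtain ⟨hn1, hn2, hn3⟩ := hn
  rw [div_lt_iff₀ (by positivity)] at hn1 hn2 hn3
  set m := n + 1 with hm_def
  have hnm : (n : ℝ) ≤ m := by simp [hm_def]
  replace hn1 : 4 < m * δ := hn1.trans_le (by gcongr)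
  replace hn2 : 4 ≤ m * (δ * x₀ ^ R) * x₀ ^ 4 :=
    hn2.le.trans (by rw [mul_assoc (m : ℝ)]; gcongr)
  replace hn3 : 4 * x₁ ^ 3 ≤ m * (δ / (x₁ * x₁ ^ R)) := hn3.le.trans (by gcongr)
  have hμ0 : ConcentratedOn (Set.Ici 0) (μ ^ m) := (hμ.mono Set.Icc_subset_Ici_self).pow_Ici m
  have hν0 : ConcentratedOn (Set.Ici 0) (ν ^ m) := (hν.mono Set.Icc_subset_Ici_self).pow_Ici m
  have hμ1 : mass (μ ^ m) = 1 := by rw [mass_pow, hμm, one_pow]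
  have hν1 : mass (ν ^ m) = 1 := by rw [mass_pow, hνm, one_pow]
  set W : ℝ[X] := C (1 - q₁) + C q₁ * X ^ 5 with hW
  set W' : ℝ[X] := C (1 - q₂) * X ^ 3 + C q₂ * X ^ 8 with hW'
  have hWx : ∀ x, W.eval x = 1 - q₁ + q₁ * x ^ 5 := fun x => by simp [hW]
  have hWx' : ∀ x, W'.eval x = (1 - q₂) * x ^ 3 + q₂ * x ^ 8 := fun x => by simp [hW']
  have hA1 : (toPoly Nat.ceil (μ ^ m)).eval 1 = 1 := by
    rw [eval_toPoly]; simpa using hμ1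
  have hB1 : (toPoly Nat.floor (ν ^ m)).eval 1 = 1 := by
    rw [eval_toPoly]; simpa using hν1
  obtain ⟨N, hN⟩ := exists_domLe_ofPoly_mul_pow
    (P := toPoly Nat.ceil (μ ^ m) * W) (Q := toPoly Nat.floor (ν ^ m) * W')
    (by simp only [eval_mul, hWx, hWx', hA1, hB1]; ring)
    (by
      have e1 := hμ0.derivative_toPoly_ceil_le hμ1
      have e2 := hν0.le_derivative_toPoly_floor hν1
      rw [mean_pow hμm] at e1
      rw [mean_pow hνm] at e2
      have e3 : (derivative W).eval 1 = q₁ * 5 := by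
        simp [hW]; norm_num
      have e4 : (derivative W').eval 1 = (1 - q₂) * 3 + q₂ * 8 := by
        simp [hW']; norm_num
      simp only [derivative_mul, eval_add, eval_mul, hWx, hWx', hA1, hB1, e3, e4]
      rw [hδ_def] at hn1
      linarith)
    (fun x hx hx1 => by
      have ha := hμ.expect_rpow_pos subset_rfl hμm hx
      have hb := hν.expect_rpow_pos subset_rfl hνm hx
      rw [eval_mul, eval_mul, hWx, hWx']
      refine mul_eval_lt_of_lt_one h₁ h₂ hx hx1 (pow_pos ha m) (pow_le_pow_left₀ hb.le
        (h.expect_rpow_le_of_le_one hm hμu hνu hx hx1.le) m) ?_ ?_ fun hxx =>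
        lt_mul_pow_of_lt_one hb (by positivity) hx₀ hxx hx1
          (h.expect_rpow_ge_of_lt_one hμm hνm hμ hν hx₀ hR hxx hx1.le) hn2
      · rw [← expect_rpow_pow _ hx]
        exact hμ0.mul_le_eval_toPoly_ceil hx hx1.le
      · rw [← expect_rpow_pow _ hx]
        exact hν0.mul_eval_toPoly_floor_le hx hx1.le)
    (fun x hx1 => by
      have hx : 0 < x := one_pos.trans hx1
      have ha := hμ.expect_rpow_pos subset_rfl hμm hx
      rw [eval_mul, eval_mul, hWx, hWx']
      refine mul_eval_lt_of_one_lt h₁ h₂ hx1 (pow_pos ha m) (pow_le_pow_left₀ ha.le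
        (h.expect_rpow_le_of_one_le hm hμu hνu hx1.le) m) ?_ ?_ fun hxx =>
        mul_pow_lt_of_one_lt ha (by positivity) hx1 hxx
          (h.expect_rpow_ge_of_one_lt hμm hνm hμ hν hR hx1.le hxx) hn3
      · rw [← expect_rpow_pow _ hx]
        exact hμ0.eval_toPoly_ceil_le hx1.le
      · rw [← expect_rpow_pow _ hx]
        exact hν0.le_mul_eval_toPoly_floor hx1.le)
    (show (0 : ℝ) < 1 - q₃ by linarith) hq₃
  refine ⟨n, N, hn1, ?_⟩
  have e1 : ofPoly W = gamble 0 5 q₁ := by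
    simpa only [pow_zero, mul_one, Nat.cast_zero, Nat.cast_ofNat] using
      ofPoly_C_mul_X_pow_add q₁ 0 5
  have e2 : ofPoly W' = gamble 3 8 q₂ := by
    simpa only [Nat.cast_ofNat] using ofPoly_C_mul_X_pow_add q₂ 3 8
  have e3 : ofPoly (C (1 - q₃) + C q₃ * X) = gamble 0 1 q₃ := by
    simpa only [pow_zero, pow_one, mul_one, Nat.cast_zero, Nat.cast_one] using
      ofPoly_C_mul_X_pow_add q₃ 0 1
  rw [map_mul, map_mul, map_mul, map_mul, map_pow ofPoly, e1, e2, e3] at hN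
  have hc1 : ConcentratedOn Set.univ (gamble 0 1 q₃ ^ (N + 1)) := by
    refine ConcentratedOn.mono (Set.subset_univ _) (ConcentratedOn.pow_Ici ?_ _)
    exact (concentratedOn_single (by simp) (by linarith)).add
      (concentratedOn_single (by simp) hq₃.le)
  exact (((hμ0.domLe_ofPoly_ceil.mul_right (concentratedOn_gamble h₁)).mul_right hc1).trans
    hN).trans ((hν0.domLe_ofPoly_floor.mul_right (concentratedOn_gamble h₂)).mul_right hc1)

lemma ConcentratedOn.of_support_subset {s : Set ℝ} (hμ : ConcentratedOn Set.univ μ)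
    (hs : (μ.coeff.support : Set ℝ) ⊆ s) : ConcentratedOn s μ := fun φ hφ => by
  have h : expect φ μ = expect (s.indicator φ) μ := by
    simp only [expect_eq_sum _ μ Finset.Subset.rfl]
    exact Finset.sum_congr rfl fun r hr => by rw [Set.indicator_of_mem (hs hr)]
  rw [h]
  exact hμ _ fun r _ => Set.indicator_nonneg hφ r

/-- A strict stochastic dominance relation survives, after enough repetitions, being offset by
a bounded gamble, provided enough independent noise is added on both sides. -/
theorem DomLe.exists_domLe_pow_mul (h : DomLe μ ν) (hμm : mass μ = 1) (hνm : mass ν = 1)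
    (hμ : ConcentratedOn Set.univ μ) (hν : ConcentratedOn Set.univ ν) (hne : ν ≠ μ)
    {q₁ q₂ q₃ : ℝ} (h₁ : q₁ ∈ Set.Ioo 0 1) (h₂ : q₂ ∈ Set.Ioo 0 1) (h₃ : q₃ ∈ Set.Ioo 0 1) :
    ∃ n N : ℕ,
      DomLe (μ ^ (n + 1) * gamble 0 5 q₁ * gamble 0 1 q₃ ^ (N + 1))
        (ν ^ (n + 1) * gamble 3 8 q₂ * gamble 0 1 q₃ ^ (N + 1)) ∧
      ν ^ (n + 1) * gamble 3 8 q₂ * gamble 0 1 q₃ ^ (N + 1) ≠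
        μ ^ (n + 1) * gamble 0 5 q₁ * gamble 0 1 q₃ ^ (N + 1) := by
  obtain ⟨c, hc⟩ : ∃ c : ℝ, ∀ r ∈ μ.coeff.support ∪ ν.coeff.support, |r| ≤ c := by
    obtain ⟨c, hc⟩ := ((μ.coeff.support ∪ ν.coeff.support).finite_toSet.image abs).bddAbove
    exact ⟨c, fun r hr => hc ⟨r, hr, rfl⟩⟩
  have hshift : ∀ κ, ConcentratedOn Set.univ κ →
      κ.coeff.support ⊆ μ.coeff.support ∪ ν.coeff.support →
      ConcentratedOn (Set.Icc 0 (|c| + |c|)) (κ * single |c| 1) := fun κ hκ hsub =>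
    (hκ.of_support_subset (s := Set.Icc (-|c|) |c|) fun r hr =>
      abs_le.1 ((hc r (hsub hr)).trans (le_abs_self c))).mul
      (t := {|c|}) (fun r hr r' hr' => by
        rw [Set.mem_singleton_iff.1 hr']
        exact ⟨by linarith [hr.1], by linarith [hr.2]⟩)
      (concentratedOn_single rfl zero_le_one)
  have hσ : ConcentratedOn Set.univ (single |c| (1 : ℝ)) :=
    concentratedOn_single (Set.mem_univ _) zero_le_one
  have hσm : mass (single |c| 1) = 1 := by simp [mass]
  have hinv : ∀ (κ : AddMonoidAlgebra ℝ ℝ) (m : ℕ),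
      (κ * single |c| 1) ^ m * single (-(m * |c|)) 1 = κ ^ m := fun κ m => by
    rw [mul_pow, single_pow, mul_assoc, single_mul_single]
    simp [← one_def]
  have hm1 : ∀ κ, mass κ = 1 → mass (κ * single |c| 1) = 1 := fun κ hκ => by
    rw [mass_mul, hκ, hσm, one_mul]
  obtain ⟨n, N, h4, hD⟩ := (h.mul_right hσ).exists_domLe_pow_mul_of_Icc (hm1 μ hμm) (hm1 ν hνm)
    (by positivity) (hshift μ hμ Finset.subset_union_left) (hshift ν hν Finset.subset_union_right)
    (fun he => hne (by rw [← pow_one ν, ← pow_one μ, ← hinv ν 1, ← hinv μ 1, he]))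
    h₁ h₂ h₃
  rw [mean_mul hνm hσm, mean_mul hμm hσm] at h4
  refine ⟨n, N, ?_, fun he => ?_⟩
  · have := hD.mul_right (κ := single (-((n + 1 : ℕ) * |c|)) 1)
      (concentratedOn_single (Set.mem_univ _) zero_le_one)
    rw [← hinv μ, ← hinv ν]
    convert this using 1 <;> ring
  · have hg : ∀ k, mass (gamble 0 1 q₃ ^ k) = 1 := fun k => by
      rw [mass_pow, mass_gamble, one_pow]
    have hp : ∀ κ, mass κ = 1 → mass (κ ^ (n + 1)) = 1 := fun κ hκ => by
      rw [mass_pow, hκ, one_pow]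
    have h5 := congrArg mean he
    rw [mean_mul (by rw [mass_mul, hp ν hνm, mass_gamble, one_mul]) (hg _),
      mean_mul (by rw [mass_mul, hp μ hμm, mass_gamble, one_mul]) (hg _),
      mean_mul (hp ν hνm) (mass_gamble _ _ _), mean_mul (hp μ hμm) (mass_gamble _ _ _),
      mean_pow hνm, mean_pow hμm] at h5
    simp only [mean, expect_gamble] at h4 h5
    linarith [h₁.2, h₂.1]

end Domination

section Games

open AddMonoidAlgebra

variable {N : ℕ} {G H : Game N} {p : Profile G} {q : Profile H} {i j : Fin N}

/-- The payoff lottery of player `i` from `ai` as an element of the monoid algebra. -/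
def lot (G : Game N) (p : Profile G) (i : Fin N) (ai : G.A i) : AddMonoidAlgebra ℝ ℝ :=
  ∑ a : (j : Fin N) → G.A j, single (G.u a i) (weight G (Function.update p i (delta ai)) a)

lemma coeff_lot (ai : G.A i) : ⇑(lot G p i ai).coeff = payMass G p i ai := by
  funext t
  simp only [lot, payMass, coeff_sum, Finsupp.finsetSum_apply, coeff_single, Finsupp.single_apply]

lemma expect_lot (φ : ℝ → ℝ) (ai : G.A i) : expect φ (lot G p i ai) =
    ∑ a : (j : Fin N) → G.A j, weight G (Function.update p i (delta ai)) a * φ (G.u a i) := by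
  simp only [lot, map_sum, expect_single]

lemma isMixed_update (hp : IsMixed G p) (ai : G.A i) :
    IsMixed G (Function.update p i (delta ai)) := fun k => by
  rcases eq_or_ne k i with rfl | hk
  · simp only [Function.update_self, delta]
    exact ⟨fun _ => by split_ifs <;> norm_num, by
      rw [Finset.sum_eq_single ai] <;> simp +contextual⟩
  · rw [Function.update_of_ne hk]
    exact hp k

lemma sum_weight_mul (hp : IsMixed G p) (j : Fin N) (φ : G.A j → ℝ) :
    ∑ a : (k : Fin N) → G.A k, weight G p a * φ (a j) = ∑ y, p j y * φ y := by
  have h1 : ∀ a : (k : Fin N) → G.A k, weight G p a * φ (a j) =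
      ∏ k, p k (a k) * if h : k = j then φ (h ▸ a k) else 1 := fun a => by
    rw [Finset.prod_mul_distrib, weight, Finset.prod_dite_eq' Finset.univ j]
    simp
  simp only [h1]
  rw [← Fintype.piFinset_univ,
    ← Finset.prod_univ_sum (fun k => (Finset.univ : Finset (G.A k)))
      fun k y => p k y * if h : k = j then φ (h ▸ y) else 1,
    Finset.prod_eq_single j]
  · simp
  · intro k _ hk
    simp [hk, (hp k).2]
  · simp

lemma weight_nonneg (hp : IsMixed G p) (a : (k : Fin N) → G.A k) : 0 ≤ weight G p a :=
  Finset.prod_nonneg fun k _ => (hp k).1 _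

lemma concentratedOn_lot (hp : IsMixed G p) (ai : G.A i) :
    ConcentratedOn Set.univ (lot G p i ai) := fun φ hφ => by
  rw [expect_lot]
  exact Finset.sum_nonneg fun a _ =>
    mul_nonneg (weight_nonneg (isMixed_update hp ai) a) (hφ _ trivial)

lemma mass_lot (hp : IsMixed G p) (ai : G.A i) : mass (lot G p i ai) = 1 := by
  rw [mass, expect_lot, sum_weight_mul (isMixed_update hp ai) i fun _ => 1]
  simpa using (isMixed_update hp ai i).2

lemma weight_comp (c : (k : Fin N) → G.A k × H.A k) :
    weight (G.comp H) (prodProfile p q) c =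
      weight G p (fun k => (c k).1) * weight H q (fun k => (c k).2) :=
  Finset.prod_mul_distrib

lemma delta_prod {α β : Type*} (a : α) (b : β) (c : α × β) :
    delta (a, b) c = delta a c.1 * delta b c.2 := by
  obtain ⟨x, y⟩ := c
  by_cases hx : x = a <;> by_cases hy : y = b <;> simp [delta, hx, hy]

lemma update_prodProfile_s12 (ai : G.A i) (bi : H.A i) :
    Function.update (prodProfile p q) i (delta ((ai, bi) : (G.comp H).A i)) =
      prodProfile (Function.update p i (delta ai)) (Function.update q i (delta bi)) := by
  funext k c
  rcases eq_or_ne k i with rfl | hk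
  · simp only [prodProfile, Function.update_self]
    exact delta_prod ai bi c
  · simp only [prodProfile, Function.update_of_ne hk]

lemma lot_comp (ai : G.A i) (bi : H.A i) :
    lot (G.comp H) (prodProfile p q) i (ai, bi) = lot G p i ai * lot H q i bi := by
  unfold lot
  rw [Finset.sum_mul_sum, ← Fintype.sum_prod_type']
  refine Fintype.sum_equiv (Equiv.arrowProdEquivProdArrow (Fin N) G.A H.A) _ _ fun c => ?_
  rw [single_mul_single]
  exact congrArg (single _) ((congrArg (fun r => weight (G.comp H) r c)
    (update_prodProfile_s12 ai bi)).trans (weight_comp c))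

/-- The lottery of a player whose payoff depends only on the actions of `i` and `j`. -/
lemma lot_eq_sum (hp : IsMixed G p) (hij : j ≠ i) {F : G.A i → G.A j → ℝ}
    (hF : ∀ a, G.u a i = F (a i) (a j)) (x : G.A i) :
    lot G p i x = ∑ y, single (F x y) (p j y) := by
  have h1 : ∀ a : (k : Fin N) → G.A k,
      single (G.u a i) (weight G (Function.update p i (delta x)) a) =
      single (F x (a j)) (weight G (Function.update p i (delta x)) a) := fun a => by
    rw [hF]
    rcases eq_or_ne (a i) x with h | h
    · rw [h]
    · have : weight G (Function.update p i (delta x)) a = 0 :=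
        Finset.prod_eq_zero (Finset.mem_univ i) (by simp [delta, h])
      rw [this, single_zero, single_zero]
  rw [lot, Finset.sum_congr rfl fun a _ => h1 a]
  refine coeff_inj.1 (Finsupp.ext fun t => ?_)
  simp only [coeff_sum, Finsupp.finsetSum_apply, coeff_single, Finsupp.single_apply]
  have := sum_weight_mul (isMixed_update hp x) j fun y => if F x y = t then 1 else 0
  simpa [Function.update_of_ne hij] using this

variable {S : SolCon N} {μ ν μ' ν' : AddMonoidAlgebra ℝ ℝ} {s t s' t' : ℝ}

/-- In some solution, player `i` has two actions with payoff lotteries `μ` and `ν`, played with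
probabilities `s` and `t`. -/
def Attains (S : SolCon N) (i : Fin N) (μ ν : AddMonoidAlgebra ℝ ℝ) (s t : ℝ) : Prop :=
  ∃ G, ∃ p ∈ S G, ∃ a b : G.A i, lot G p i a = μ ∧ lot G p i b = ν ∧ p i a = s ∧ p i b = t

lemma Attains.mul (hBr : Bracketing S) (h : Attains S i μ ν s t) (h' : Attains S i μ' ν' s' t') :
    Attains S i (μ * μ') (ν * ν') (s * s') (t * t') := by
  obtain ⟨G, p, hp, a, b, rfl, rfl, rfl, rfl⟩ := h
  obtain ⟨H, q, hq, a', b', rfl, rfl, rfl, rfl⟩ := h'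
  exact ⟨G.comp H, prodProfile p q, hBr G H p q hp hq, (a, a'), (b, b'), lot_comp a a',
    lot_comp b b', rfl, rfl⟩

lemma Attains.pow (hBr : Bracketing S) (h : Attains S i μ ν s t) (n : ℕ) :
    Attains S i (μ ^ (n + 1)) (ν ^ (n + 1)) (s ^ (n + 1)) (t ^ (n + 1)) := by
  induction n with
  | zero => simpa using h
  | succ n ih => simpa only [pow_succ _ (n + 1)] using ih.mul hBr h

lemma Attains.le (hDM : DistributionMonotone S) (h : Attains S i μ ν s t) (hd : DomLe μ ν)
    (hne : ν ≠ μ) : s ≤ t := by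
  obtain ⟨G, p, hp, a, b, rfl, rfl, rfl, rfl⟩ := h
  refine hDM G p hp i b a ?_
  rw [← coeff_lot, ← coeff_lot]
  exact fosdgtF_coeff_iff.2 ⟨hd, hne⟩

/-- No player ever plays a strictly dominated action. -/
def AvoidsDominated (S : SolCon N) : Prop :=
  ∀ G, ∀ p ∈ S G, ∀ i, ∀ ai : G.A i, StrictlyDominated G i ai → p i ai = 0

/-- The game in which every player chooses between `0` and `-ε`. -/
def constGame (N : ℕ) (ε : ℝ) : Game N where
  A := fun _ => Bool
  fintypeA := fun _ => inferInstance
  nonemptyA := fun _ => inferInstance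
  u := fun a i => if a i then 0 else -ε

lemma constGame_u {ε : ℝ} (a : (k : Fin N) → (constGame N ε).A k) (x : Bool) :
    (constGame N ε).u (Function.update a i x) i = if x then 0 else -ε :=
  congrArg (fun b : Bool => if b then (0 : ℝ) else -ε) (Function.update_self i x a)

lemma lot_eq_single (hp : IsMixed G p) {x : G.A i} {r : ℝ}
    (h : ∀ a, G.u (Function.update a i x) i = r) : lot G p i x = single r 1 := by
  have h1 : ∀ a : (k : Fin N) → G.A k,
      single (G.u a i) (weight G (Function.update p i (delta x)) a) =
      single r (weight G (Function.update p i (delta x)) a) := fun a => by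
    rcases eq_or_ne (a i) x with hx | hx
    · rw [← h a, ← hx, Function.update_eq_self]
    · have : weight G (Function.update p i (delta x)) a = 0 :=
        Finset.prod_eq_zero (Finset.mem_univ i) (by simp [delta, hx])
      rw [this, single_zero, single_zero]
  have h2 := mass_lot hp x
  rw [mass, expect_lot] at h2
  simp only [mul_one] at h2
  refine coeff_inj.1 (Finsupp.ext fun y => ?_)
  rw [lot, Finset.sum_congr rfl fun a _ => h1 a]
  simp only [coeff_sum, Finsupp.finsetSum_apply, coeff_single, Finsupp.single_apply]
  split_ifs <;> simp [h2]

lemma attains_constGame (hS : IsSolutionConcept S) (hDom : AvoidsDominated S) (i : Fin N)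
    {ε : ℝ} (hε : 0 < ε) : Attains S i (single 0 1) (single (-ε) 1) 1 0 := by
  obtain ⟨⟨p, hp⟩, hmix⟩ := hS (constGame N ε)
  have h0 : p i false = 0 := hDom _ p hp i false ⟨true, fun a => by
    rw [constGame_u, constGame_u]; simpa using hε⟩
  have h1 := (hmix p hp i).2
  refine ⟨constGame N ε, p, hp, true, false, lot_eq_single (hmix p hp) fun a => constGame_u a true,
    lot_eq_single (hmix p hp) fun a => constGame_u a false, ?_, h0⟩
  · have : p i true + p i false = 1 := by
      rw [← h1]; exact (Fintype.sum_bool (p i)).symm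
    linarith

lemma domLe_single {x y : ℝ} (h : x ≤ y) : DomLe (single x 1) (single y 1) := fun t => by
  simpa only [expect_single, one_mul] using step_antitone h

lemma eq_zero_of_lot_eq_single (hS : IsSolutionConcept S) (hBr : Bracketing S)
    (hDM : DistributionMonotone S) (hDom : AvoidsDominated S) (hp : p ∈ S G) {a b : G.A i}
    {x y : ℝ} (ha : lot G p i a = single x 1) (hb : lot G p i b = single y 1) (hxy : x < y) :
    p i a = 0 := by
  have h1 : Attains S i (single x 1) (single y 1) (p i a) (p i b) :=
    ⟨G, p, hp, a, b, ha, hb, rfl, rfl⟩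
  have h2 := h1.mul hBr (attains_constGame hS hDom i (half_pos (sub_pos.2 hxy)))
  simp only [single_mul_single, mul_one, mul_zero] at h2
  refine le_antisymm (h2.le hDM (domLe_single (by linarith)) fun he => ?_)
    (((hS G).2 p hp i).1 a)
  have := congrArg mean he
  simp only [mean, expect_single, one_mul] at this
  linarith

end Games

section PairGames

open AddMonoidAlgebra

variable {N : ℕ} {S : SolCon N} {i j : Fin N}

/-- The game played by `i` and `j`, with three actions each, in which `i` gets `f (a i) (a j)`
and `j` gets `g (a j) (a i)`. -/
def pairGame (i j : Fin N) (f g : Fin 3 → Fin 3 → ℝ) : Game N where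
  A := fun _ => Fin 3
  fintypeA := fun _ => inferInstance
  nonemptyA := fun _ => inferInstance
  u := fun a k => if k = i then f (a i) (a j) else if k = j then g (a j) (a i) else 0

section

variable {f g : Fin 3 → Fin 3 → ℝ} {p : Profile (pairGame i j f g)}

lemma pairGame_u_left (a : (k : Fin N) → Fin 3) :
    (pairGame i j f g).u a i = f (a i) (a j) := if_pos rfl

lemma pairGame_u_right (hij : j ≠ i) (a : (k : Fin N) → Fin 3) :
    (pairGame i j f g).u a j = g (a j) (a i) := (if_neg hij).trans (if_pos rfl)

lemma lot_pairGame_left (hp : IsMixed (pairGame i j f g) p) (hij : j ≠ i) (x : Fin 3) :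
    lot (pairGame i j f g) p i x =
      single (f x 0) (p j (0 : Fin 3)) + single (f x 1) (p j (1 : Fin 3)) +
        single (f x 2) (p j (2 : Fin 3)) :=
  (lot_eq_sum hp hij pairGame_u_left x).trans
    (Fin.sum_univ_three fun y : Fin 3 => single (f x y) (p j y))

lemma lot_pairGame_right (hp : IsMixed (pairGame i j f g) p) (hij : j ≠ i) (y : Fin 3) :
    lot (pairGame i j f g) p j y =
      single (g y 0) (p i (0 : Fin 3)) + single (g y 1) (p i (1 : Fin 3)) +
        single (g y 2) (p i (2 : Fin 3)) :=
  (lot_eq_sum hp hij.symm (pairGame_u_right hij) y).trans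
    (Fin.sum_univ_three fun x : Fin 3 => single (g y x) (p i x))

lemma strictlyDominated_pairGame_left (hij : j ≠ i) {x x' : Fin 3} (h : ∀ y, f x y < f x' y) :
    StrictlyDominated (pairGame i j f g) i x := by
  refine ⟨x', fun a => ?_⟩
  have e : ∀ z : Fin 3, (pairGame i j f g).u (Function.update a i z) i = f z (a j) := fun z =>
    (pairGame_u_left _).trans (congrArg₂ f (Function.update_self i z a)
      (Function.update_of_ne hij z a))
  rw [e, e]
  exact h _

lemma strictlyDominated_pairGame_right (hij : j ≠ i) {y y' : Fin 3}
    (h : ∀ x, g y x < g y' x) : StrictlyDominated (pairGame i j f g) j y := by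
  refine ⟨y', fun a => ?_⟩
  have e : ∀ z : Fin 3, (pairGame i j f g).u (Function.update a j z) j = g z (a i) := fun z =>
    (pairGame_u_right hij _).trans (congrArg₂ g (Function.update_self j z a)
      (Function.update_of_ne hij.symm z a))
  rw [e, e]
  exact h _

lemma sum_pairGame (hp : IsMixed (pairGame i j f g) p) (k : Fin N) :
    p k (0 : Fin 3) + p k (1 : Fin 3) + p k (2 : Fin 3) = 1 :=
  (Fin.sum_univ_three fun x : Fin 3 => p k x).symm.trans (hp k).2

end

/-- Any binary gamble arises with some interior probability against a safe alternative, both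
being played with positive probability alongside an inferior safe action that is not played. -/
lemma exists_lot_eq_gamble (hS : IsSolutionConcept S) (hBr : Bracketing S)
    (hDM : DistributionMonotone S) (hDom : AvoidsDominated S) (hij : j ≠ i) {l r h c : ℝ}
    (hlr : l < r) (hrh : r < h) (hcr : c < r) :
    ∃ q ∈ Set.Ioo (0 : ℝ) 1, ∃ G, ∃ p ∈ S G, ∃ x y z : G.A i,
      lot G p i x = gamble l h q ∧ lot G p i y = single r 1 ∧ lot G p i z = single c 1 ∧
      0 < p i x ∧ 0 < p i y ∧ p i z = 0 := by
  set f : Fin 3 → Fin 3 → ℝ := ![![h, l, l], ![r, r, r], ![c, c, c]]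
  set g : Fin 3 → Fin 3 → ℝ := ![![0, 1, 1], ![1, 0, 0], ![-1, -1, -1]]
  obtain ⟨⟨p, hp⟩, hmix⟩ := hS (pairGame i j f g)
  replace hmix := hmix p hp
  have hz : p i (2 : Fin 3) = 0 := hDom _ p hp i (2 : Fin 3)
    (strictlyDominated_pairGame_left hij (x' := 1) fun y => by fin_cases y <;> simpa [f])
  have hw : p j (2 : Fin 3) = 0 := hDom _ p hp j (2 : Fin 3)
    (strictlyDominated_pairGame_right hij (y' := 0) fun y => by
      fin_cases y <;> simp [g])
  have hi := sum_pairGame hmix i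
  have hj := sum_pairGame hmix j
  rw [hz, add_zero] at hi
  rw [hw, add_zero] at hj
  have lx := lot_pairGame_left hmix hij 0
  have ly := lot_pairGame_left hmix hij 1
  have lz := lot_pairGame_left hmix hij 2
  have lL := lot_pairGame_right hmix hij 0
  have lR := lot_pairGame_right hmix hij 1
  rw [hw, single_zero, add_zero] at lx ly lz
  rw [hz, single_zero, add_zero] at lL lR
  have nonneg : ∀ k (x : Fin 3), 0 ≤ p k x := fun k x => (hmix k).1 x
  have hx0 := nonneg i 0
  have hy0 := nonneg i 1
  have hL0 := nonneg j 0
  have hR0 := nonneg j 1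
  set X := p i (0 : Fin 3)
  set Y := p i (1 : Fin 3)
  set L := p j (0 : Fin 3)
  set R := p j (1 : Fin 3)
  replace lx : lot _ p i (0 : Fin 3) = single h L + single l R := lx
  replace ly : lot _ p i (1 : Fin 3) = single r 1 := by
    rw [ly, ← hj]; exact (single_add r L R).symm
  replace lz : lot _ p i (2 : Fin 3) = single c 1 := by
    rw [lz, ← hj]; exact (single_add c L R).symm
  replace lL : lot _ p j (0 : Fin 3) = single 0 X + single 1 Y := lL
  replace lR : lot _ p j (1 : Fin 3) = single 1 X + single 0 Y := lR
  have hXR : X = 0 → R = 0 := fun hX => by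
    rw [hX, zero_add] at hi
    rw [hX, hi, single_zero, zero_add] at lL lR
    exact eq_zero_of_lot_eq_single hS hBr hDM hDom hp lR lL one_pos
  have hYL : Y = 0 → L = 0 := fun hY => by
    rw [hY, add_zero] at hi
    rw [hY, hi, single_zero, add_zero] at lL lR
    exact eq_zero_of_lot_eq_single hS hBr hDM hDom hp lL lR one_pos
  have hLX : L = 0 → X = 0 := fun hL => by
    rw [hL, zero_add] at hj
    rw [hL, hj, single_zero, zero_add] at lx
    exact eq_zero_of_lot_eq_single hS hBr hDM hDom hp lx ly hlr
  have hRY : R = 0 → Y = 0 := fun hR => by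
    rw [hR, add_zero] at hj
    rw [hR, hj, single_zero, add_zero] at lx
    exact eq_zero_of_lot_eq_single hS hBr hDM hDom hp ly lx hrh
  have hX : X ≠ 0 := fun hX => by linarith [hRY (hXR hX)]
  have hY : Y ≠ 0 := fun hY => hX (hLX (hYL hY))
  have hL : L ≠ 0 := fun hL => hX (hLX hL)
  have hR : R ≠ 0 := fun hR => hY (hRY hR)
  refine ⟨L, ⟨hL0.lt_of_ne' hL, ?_⟩, _, p, hp, (0 : Fin 3), (1 : Fin 3), (2 : Fin 3), ?_, ly, lz,
    hx0.lt_of_ne' hX, hy0.lt_of_ne' hY, hz⟩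
  · linarith [hR0.lt_of_ne' hR]
  · rw [lx, gamble, ← hj, add_sub_cancel_left, add_comm]

end PairGames

/-- bracketing + distribution-monotonicity + never playing strictly
dominated actions imply that `S` refines FOSD-Nash. -/
theorem stmt12 {N : ℕ} (hN : 2 ≤ N) (S : SolCon N) (hS : IsSolutionConcept S)
    (hBr : Bracketing S) (hDM : DistributionMonotone S)
    (hDom : ∀ G, ∀ p ∈ S G, ∀ i, ∀ ai : G.A i, StrictlyDominated G i ai → p i ai = 0) :
    ∀ G, ∀ p ∈ S G, IsFOSDNash G p := by
  intro G p hp i ai ⟨bi, hb⟩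
  obtain ⟨j, hij⟩ : ∃ j : Fin N, j ≠ i :=
    haveI : Nontrivial (Fin N) := Fin.nontrivial_iff_two_le.2 hN
    exists_ne i
  have hmix := (hS G).2 p hp
  by_contra hne
  have hpos : 0 < p i ai := ((hmix i).1 ai).lt_of_ne' hne
  rw [← coeff_lot, ← coeff_lot, fosdgtF_coeff_iff] at hb
  obtain ⟨q₁, h₁, G₁, p₁, hp₁, x₁, y₁, z₁, lx₁, -, lz₁, px₁, -, pz₁⟩ :=
    exists_lot_eq_gamble hS hBr hDM hDom hij (l := 0) (r := 9 / 2) (h := 5) (c := 4)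
      (by norm_num) (by norm_num) (by norm_num)
  obtain ⟨q₂, h₂, G₂, p₂, hp₂, x₂, y₂, -, lx₂, ly₂, -, px₂, py₂, -⟩ :=
    exists_lot_eq_gamble hS hBr hDM hDom hij (l := -1) (r := 0) (h := 4) (c := -1)
      (by norm_num) (by norm_num) (by norm_num)
  obtain ⟨q₃, h₃, G₃, p₃, hp₃, x₃, -, -, lx₃, -, -, px₃, -, -⟩ :=
    exists_lot_eq_gamble hS hBr hDM hDom hij (l := 0) (r := 1 / 2) (h := 1) (c := 0)
      (by norm_num) (by norm_num) (by norm_num)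
  obtain ⟨n, M, hd, hne'⟩ := hb.1.exists_domLe_pow_mul (mass_lot hmix ai) (mass_lot hmix bi)
    (concentratedOn_lot hmix ai) (concentratedOn_lot hmix bi) hb.2 h₁ h₂ h₃
  have t₀ : Attains S i _ _ _ _ := ⟨G, p, hp, ai, bi, rfl, rfl, rfl, rfl⟩
  have t₁ : Attains S i _ _ _ _ := ⟨G₁, p₁, hp₁, x₁, z₁, lx₁, lz₁, rfl, pz₁⟩
  have t₂ : Attains S i _ _ _ _ := ⟨G₂, p₂, hp₂, y₂, x₂, ly₂, lx₂, rfl, rfl⟩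
  have t₃ : Attains S i _ _ _ _ := ⟨G₃, p₃, hp₃, x₃, x₃, lx₃, lx₃, rfl, rfl⟩
  have t := ((t₀.pow hBr n).mul hBr (t₁.mul hBr t₂)).mul hBr (t₃.pow hBr M)
  have e₁ : gamble 0 5 q₁ * AddMonoidAlgebra.single 0 1 = gamble 0 5 q₁ := mul_one _
  have e₂ : AddMonoidAlgebra.single 4 1 * gamble (-1) 4 q₂ = gamble 3 8 q₂ := by
    simp only [gamble, mul_add, AddMonoidAlgebra.single_mul_single, one_mul]
    norm_num
  rw [e₁, e₂] at t
  have hle := t.le hDM hd hne'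
  rw [zero_mul, mul_zero, zero_mul] at hle
  exact hle.not_gt (by positivity)


end Paper
end
end

section
/- Let Φ be a monotone additive statistic defined on all compactly supported real-valued lotteries, and suppose there exists β > 0 with β ≠ 1 such that Φ[βX] = βΦ[X] for every compactly supported lottery X. Then there exist λ_1, λ_2, λ_3 ≥ 0 with λ_1+λ_2+λ_3 = 1 such that Φ[X] = λ_1·min(supp X) + λ_2·E[X] + λ_3·max(supp X) for every compactly supported lottery X. -/
open Filter Topology MeasureTheory

noncomputable section

namespace Paper

/-! ## Basic facts about lotteries -/

/-- A lottery is a compactly supported probability measure. -/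
structure IsLottery (μ : Measure ℝ) : Prop where
  prob : IsProbabilityMeasure μ
  supp : CompSupp μ

lemma mconv_apply (μ ν : Measure ℝ) {s : Set ℝ} (hs : MeasurableSet s) :
    mconv μ ν s = μ.prod ν ((fun z : ℝ × ℝ => z.1 + z.2) ⁻¹' s) :=
  Measure.map_apply (by fun_prop) hs

lemma mconv_Iio_eq_zero {μ ν : Measure ℝ} [SFinite μ] [SFinite ν] {a b : ℝ}
    (ha : μ (Set.Iio a) = 0) (hb : ν (Set.Iio b) = 0) : mconv μ ν (Set.Iio (a + b)) = 0 := by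
  rw [mconv_apply μ ν measurableSet_Iio]
  have h : (fun z : ℝ × ℝ => z.1 + z.2) ⁻¹' Set.Iio (a + b)
      ⊆ Set.Iio a ×ˢ Set.univ ∪ Set.univ ×ˢ Set.Iio b := by
    rintro ⟨x, y⟩ h
    simp only [Set.mem_preimage, Set.mem_Iio, Set.mem_union, Set.mem_prod, Set.mem_univ,
      and_true, true_and] at h ⊢
    by_contra! hc
    linarith
  refine measure_mono_null h (measure_union_null ?_ ?_) <;> simp [Measure.prod_prod, ha, hb]

lemma mconv_Ioi_eq_zero {μ ν : Measure ℝ} [SFinite μ] [SFinite ν] {a b : ℝ}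
    (ha : μ (Set.Ioi a) = 0) (hb : ν (Set.Ioi b) = 0) : mconv μ ν (Set.Ioi (a + b)) = 0 := by
  rw [mconv_apply μ ν measurableSet_Ioi]
  have h : (fun z : ℝ × ℝ => z.1 + z.2) ⁻¹' Set.Ioi (a + b)
      ⊆ Set.Ioi a ×ˢ Set.univ ∪ Set.univ ×ˢ Set.Ioi b := by
    rintro ⟨x, y⟩ h
    simp only [Set.mem_preimage, Set.mem_Ioi, Set.mem_union, Set.mem_prod, Set.mem_univ,
      and_true, true_and] at h ⊢
    by_contra! hc
    linarith
  refine measure_mono_null h (measure_union_null ?_ ?_) <;> simp [Measure.prod_prod, ha, hb]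

lemma mconv_Ioi_ne_zero {μ ν : Measure ℝ} [SFinite μ] [SFinite ν] {a b : ℝ}
    (ha : μ (Set.Ioi a) ≠ 0) (hb : ν (Set.Ioi b) ≠ 0) : mconv μ ν (Set.Ioi (a + b)) ≠ 0 := by
  rw [mconv_apply μ ν measurableSet_Ioi]
  have h : Set.Ioi a ×ˢ Set.Ioi b ⊆ (fun z : ℝ × ℝ => z.1 + z.2) ⁻¹' Set.Ioi (a + b) := by
    rintro ⟨x, y⟩ ⟨hx, hy⟩
    exact add_lt_add (Set.mem_Ioi.1 hx) (Set.mem_Ioi.1 hy)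
  refine fun h0 => mul_ne_zero ha hb ?_
  rw [← Measure.prod_prod]
  exact measure_mono_null h h0

lemma CompSupp.of_Iio_Ioi {μ : Measure ℝ} {a b : ℝ} (ha : μ (Set.Iio a) = 0)
    (hb : μ (Set.Ioi b) = 0) : CompSupp μ := by
  refine ⟨a, b, measure_mono_null ?_ (measure_union_null ha hb)⟩
  intro x hx
  simp only [Set.mem_compl_iff, Set.mem_Icc, not_and_or, not_le] at hx
  exact hx

lemma CompSupp.exists_Iio_Ioi {μ : Measure ℝ} (h : CompSupp μ) :
    ∃ a b, μ (Set.Iio a) = 0 ∧ μ (Set.Ioi b) = 0 := by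
  obtain ⟨a, b, h⟩ := h
  refine ⟨a, b, measure_mono_null ?_ h, measure_mono_null ?_ h⟩
  · exact fun x hx hx' => not_lt.2 hx'.1 hx
  · exact fun x hx hx' => not_lt.2 hx'.2 hx

lemma IsLottery.mconv {μ ν : Measure ℝ} (hμ : IsLottery μ) (hν : IsLottery ν) :
    IsLottery (mconv μ ν) := by
  have := hμ.prob
  have := hν.prob
  obtain ⟨a, b, ha, hb⟩ := hμ.supp.exists_Iio_Ioi
  obtain ⟨c, d, hc, hd⟩ := hν.supp.exists_Iio_Ioi
  exact ⟨Measure.isProbabilityMeasure_map (by fun_prop),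
    .of_Iio_Ioi (mconv_Iio_eq_zero ha hc) (mconv_Ioi_eq_zero hb hd)⟩

lemma IsLottery.dirac (x : ℝ) : IsLottery (Measure.dirac x) :=
  ⟨inferInstance, x, x, by simp⟩

lemma IsLottery.npow {μ : Measure ℝ} (hμ : IsLottery μ) (n : ℕ) : IsLottery (npow μ n) := by
  induction n with
  | zero => exact .dirac 0
  | succ n ih => exact ih.mconv hμ

lemma mscale_Iio {s : ℝ} (hs : 0 < s) (μ : Measure ℝ) (t : ℝ) :
    mscale s μ (Set.Iio t) = μ (Set.Iio (t / s)) := by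
  rw [mscale, Measure.map_apply (by fun_prop) measurableSet_Iio]
  congr 1
  ext x
  simp [lt_div_iff₀' hs]

lemma mscale_Iic {s : ℝ} (hs : 0 < s) (μ : Measure ℝ) (t : ℝ) :
    mscale s μ (Set.Iic t) = μ (Set.Iic (t / s)) := by
  rw [mscale, Measure.map_apply (by fun_prop) measurableSet_Iic]
  congr 1
  ext x
  simp [le_div_iff₀' hs]

lemma mscale_Ioi {s : ℝ} (hs : 0 < s) (μ : Measure ℝ) (t : ℝ) :
    mscale s μ (Set.Ioi t) = μ (Set.Ioi (t / s)) := by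
  rw [mscale, Measure.map_apply (by fun_prop) measurableSet_Ioi]
  congr 1
  ext x
  simp [div_lt_iff₀' hs]

lemma IsLottery.mscale {μ : Measure ℝ} (hμ : IsLottery μ) {s : ℝ} (hs : 0 < s) :
    IsLottery (mscale s μ) := by
  have := hμ.prob
  obtain ⟨a, b, ha, hb⟩ := hμ.supp.exists_Iio_Ioi
  refine ⟨Measure.isProbabilityMeasure_map (by fun_prop),
    .of_Iio_Ioi (a := s * a) (b := s * b) ?_ ?_⟩
  · rwa [mscale_Iio hs, mul_div_cancel_left₀ a hs.ne']
  · rwa [mscale_Ioi hs, mul_div_cancel_left₀ b hs.ne']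

lemma mscale_mscale (s t : ℝ) (μ : Measure ℝ) : mscale s (mscale t μ) = mscale (s * t) μ := by
  rw [mscale, mscale, Measure.map_map (by fun_prop) (by fun_prop), mscale]
  congr 1
  ext x
  simp [mul_assoc]

lemma mscale_one (μ : Measure ℝ) : mscale 1 μ = μ := by
  simp [mscale]

/-- The distribution of the negative of a draw. -/
def mneg (μ : Measure ℝ) : Measure ℝ := mscale (-1) μ

lemma mneg_mneg (μ : Measure ℝ) : mneg (mneg μ) = μ := by
  rw [mneg, mneg, mscale_mscale]
  simpa using mscale_one μ

lemma mneg_Iio (μ : Measure ℝ) (t : ℝ) : mneg μ (Set.Iio t) = μ (Set.Ioi (-t)) := by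
  rw [mneg, mscale, Measure.map_apply (by fun_prop) measurableSet_Iio]
  congr 1
  ext x
  simp

lemma mneg_Ioi (μ : Measure ℝ) (t : ℝ) : mneg μ (Set.Ioi t) = μ (Set.Iio (-t)) := by
  rw [mneg, mscale, Measure.map_apply (by fun_prop) measurableSet_Ioi]
  congr 1
  ext x
  simp

lemma mneg_Iic (μ : Measure ℝ) (t : ℝ) : mneg μ (Set.Iic t) = μ (Set.Ici (-t)) := by
  rw [mneg, mscale, Measure.map_apply (by fun_prop) measurableSet_Iic]
  congr 1
  ext x
  simp

lemma IsLottery.mneg {μ : Measure ℝ} (hμ : IsLottery μ) : IsLottery (mneg μ) := by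
  have := hμ.prob
  obtain ⟨a, b, ha, hb⟩ := hμ.supp.exists_Iio_Ioi
  refine ⟨Measure.isProbabilityMeasure_map (by fun_prop),
    .of_Iio_Ioi (a := -b) (b := -a) ?_ ?_⟩
  · rwa [mneg_Iio, neg_neg]
  · rwa [mneg_Ioi, neg_neg]

lemma mneg_dirac (x : ℝ) : mneg (Measure.dirac x) = Measure.dirac (-x) := by
  rw [mneg, mscale, Measure.map_dirac' (by fun_prop)]
  simp

lemma mscale_mconv (s : ℝ) (μ ν : Measure ℝ) [SFinite μ] [SFinite ν] :
    mscale s (mconv μ ν) = mconv (mscale s μ) (mscale s ν) := by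
  rw [mscale, mconv, mconv, mscale, mscale, Measure.map_prod_map _ _ (by fun_prop) (by fun_prop),
    Measure.map_map (by fun_prop) (by fun_prop), Measure.map_map (by fun_prop) (by fun_prop)]
  congr 1
  ext z
  simp [mul_add]

lemma FOSDgeM.mneg {μ ν : Measure ℝ} [IsProbabilityMeasure μ] [IsProbabilityMeasure ν]
    (h : FOSDgeM μ ν) : FOSDgeM (mneg ν) (mneg μ) := by
  have hIio : ∀ t, μ (Set.Iio t) ≤ ν (Set.Iio t) := by
    intro t
    obtain ⟨u, hu, hut, hlim⟩ := exists_seq_strictMono_tendsto t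
    have hU : Set.Iio t = ⋃ n, Set.Iic (u n) := by
      ext x
      simp only [Set.mem_Iio, Set.mem_iUnion, Set.mem_Iic]
      refine ⟨fun hx => ?_, fun ⟨n, hn⟩ => hn.trans_lt (hut n)⟩
      obtain ⟨n, hn⟩ := (hlim.eventually (lt_mem_nhds hx)).exists
      exact ⟨n, hn.le⟩
    have hm : Monotone fun n => Set.Iic (u n) := fun a b hab =>
      Set.Iic_subset_Iic.2 (hu.monotone hab)
    rw [hU, hm.measure_iUnion, hm.measure_iUnion]
    exact iSup_mono fun n => h (u n)
  intro t
  rw [mneg_Iic, mneg_Iic, ← Set.compl_Iio, prob_compl_eq_one_sub measurableSet_Iio,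
    prob_compl_eq_one_sub measurableSet_Iio]
  exact tsub_le_tsub_left (hIio _) 1

lemma minSupp_mneg (μ : Measure ℝ) : minSupp (mneg μ) = -maxSupp μ := by
  rw [minSupp, maxSupp, ← Real.sSup_neg]
  congr 1
  ext x
  simp [mneg_Iio]

lemma maxSupp_mneg (μ : Measure ℝ) : maxSupp (mneg μ) = -minSupp μ := by
  rw [eq_neg_iff_add_eq_zero, add_comm, ← eq_neg_iff_add_eq_zero, ← minSupp_mneg, mneg_mneg]

lemma integral_mneg (μ : Measure ℝ) : ∫ x, x ∂(mneg μ) = -∫ x, x ∂μ := by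
  rw [mneg, mscale, integral_map (by fun_prop) (by fun_prop)]
  simp only [neg_one_mul]
  exact integral_neg _

lemma IsLottery.memLp {μ : Measure ℝ} (hμ : IsLottery μ) (p : ENNReal) : MemLp (fun x => x) p μ := by
  have := hμ.prob
  obtain ⟨a, b, h⟩ := hμ.supp
  exact memLp_of_bounded (a := a) (b := b) (ae_iff.2 h) (by fun_prop) p

lemma IsLottery.integrable {μ : Measure ℝ} (hμ : IsLottery μ) : Integrable (fun x => x) μ :=
  memLp_one_iff_integrable.1 (hμ.memLp 1)

lemma IsLottery.le_integral {μ : Measure ℝ} (hμ : IsLottery μ) {a : ℝ}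
    (ha : μ (Set.Iio a) = 0) : a ≤ ∫ x, x ∂μ := by
  have := hμ.prob
  have h : ∀ᵐ x ∂μ, a ≤ x := by
    rw [ae_iff]
    simpa [Set.Iio] using ha
  simpa using integral_mono_ae (integrable_const a) hμ.integrable h

lemma IsLottery.Iio_eq_zero {μ : Measure ℝ} (hμ : IsLottery μ) {a : ℝ} (ha : a < minSupp μ) :
    μ (Set.Iio a) = 0 := by
  obtain ⟨c, d, hc, hd⟩ := hμ.supp.exists_Iio_Ioi
  obtain ⟨x, hx, hax⟩ := exists_lt_of_lt_csSup ⟨c, hc⟩ ha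
  exact measure_mono_null (Set.Iio_subset_Iio hax.le) hx

lemma IsLottery.Ioi_ne_zero {μ : Measure ℝ} (hμ : IsLottery μ) {a : ℝ} (ha : a < maxSupp μ) :
    μ (Set.Ioi a) ≠ 0 := by
  have := hμ.prob
  obtain ⟨c, d, hc, hd⟩ := hμ.supp.exists_Iio_Ioi
  refine fun h => notMem_of_lt_csInf ha ⟨c, fun x (hx : μ (Set.Ioi x) = 0) => ?_⟩ h
  by_contra! hxc
  refine IsProbabilityMeasure.ne_zero μ (Measure.measure_univ_eq_zero.1 ?_)
  refine measure_mono_null (fun y _ => ?_) (measure_union_null hc hx)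
  exact (lt_or_ge y c).imp id fun h => hxc.trans_le h

lemma IsLottery.minSupp_le_integral {μ : Measure ℝ} (hμ : IsLottery μ) :
    minSupp μ ≤ ∫ x, x ∂μ :=
  le_of_forall_lt_imp_le_of_dense fun _ ha => hμ.le_integral (hμ.Iio_eq_zero ha)

lemma IsLottery.integral_le_maxSupp {μ : Measure ℝ} (hμ : IsLottery μ) :
    ∫ x, x ∂μ ≤ maxSupp μ := by
  have := hμ.mneg.minSupp_le_integral
  rw [minSupp_mneg, integral_mneg] at this
  linarith

lemma integral_mconv {μ ν : Measure ℝ} (hμ : IsLottery μ) (hν : IsLottery ν) :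
    ∫ x, x ∂(mconv μ ν) = ∫ x, x ∂μ + ∫ x, x ∂ν := by
  have := hμ.prob
  have := hν.prob
  rw [mconv, integral_map (by fun_prop) (by fun_prop), integral_add]
  · have h₁ := integral_fun_fst (μ := μ) (ν := ν) (fun x : ℝ => x)
    have h₂ := integral_fun_snd (μ := μ) (ν := ν) (fun x : ℝ => x)
    simp only [probReal_univ, one_smul] at h₁ h₂
    rw [h₁, h₂]
  · exact hμ.integrable.comp_fst ν
  · exact hν.integrable.comp_snd μ

lemma variance_mconv {μ ν : Measure ℝ} (hμ : IsLottery μ) (hν : IsLottery ν) :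
    ProbabilityTheory.variance (fun x => x) (mconv μ ν)
      = ProbabilityTheory.variance (fun x => x) μ + ProbabilityTheory.variance (fun x => x) ν := by
  have := hμ.prob
  have := hν.prob
  rw [mconv, ProbabilityTheory.variance_map (by fun_prop) (by fun_prop)]
  simp only [Function.comp_def]
  exact ProbabilityTheory.variance_add_prod (X := fun x : ℝ => x) (Y := fun x : ℝ => x)
    (hμ.memLp 2) (hν.memLp 2)

lemma integral_npow {μ : Measure ℝ} (hμ : IsLottery μ) (n : ℕ) :
    ∫ x, x ∂(npow μ n) = n * ∫ x, x ∂μ := by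
  induction n with
  | zero => simp [npow]
  | succ n ih =>
    rw [npow, integral_mconv (hμ.npow n) hμ, ih]
    push_cast
    ring

lemma variance_npow {μ : Measure ℝ} (hμ : IsLottery μ) (n : ℕ) :
    ProbabilityTheory.variance (fun x => x) (npow μ n) = n * ProbabilityTheory.variance (fun x => x) μ := by
  induction n with
  | zero => simp [npow]
  | succ n ih =>
    rw [npow, variance_mconv (hμ.npow n) hμ, ih]
    push_cast
    ring

lemma npow_Iio_eq_zero {μ : Measure ℝ} (hμ : IsLottery μ) {a : ℝ} (ha : μ (Set.Iio a) = 0)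
    (n : ℕ) : npow μ n (Set.Iio (n * a)) = 0 := by
  have := hμ.prob
  induction n with
  | zero => simp [npow]
  | succ n ih =>
    have := (hμ.npow n).prob
    have h := mconv_Iio_eq_zero ih ha
    rwa [← add_one_mul, ← Nat.cast_add_one] at h

lemma npow_succ_Ioi_ne_zero {μ : Measure ℝ} (hμ : IsLottery μ) {a : ℝ} (ha : μ (Set.Ioi a) ≠ 0)
    (n : ℕ) : npow μ (n + 1) (Set.Ioi ((n + 1 : ℕ) * a)) ≠ 0 := by
  have := hμ.prob
  induction n with
  | zero =>
    have h0 : npow μ 1 = μ := Measure.dirac_zero_conv μ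
    simpa [h0] using ha
  | succ n ih =>
    have := (hμ.npow (n + 1)).prob
    have h := mconv_Ioi_ne_zero ih ha
    rwa [← add_one_mul, ← Nat.cast_add_one] at h

/-- Chebyshev's inequality for the lower tail of a scaled sum. -/
lemma mscale_npow_Iic_le {μ : Measure ℝ} (hμ : IsLottery μ) {s t : ℝ} (hs : 0 < s) (n : ℕ)
    {ε : ℝ} (hε : 0 < ε) (ht : t + ε ≤ s * n * ∫ x, x ∂μ) :
    (mscale s (npow μ n)).real (Set.Iic t)
      ≤ s * (s * n) * ProbabilityTheory.variance (fun x => x) μ / ε ^ 2 := by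
  have := (hμ.npow n).prob
  have hc : 0 < ε / s := by positivity
  have h := ProbabilityTheory.meas_ge_le_variance_div_sq ((hμ.npow n).memLp 2) hc
  rw [variance_npow hμ] at h
  rw [integral_npow hμ n] at h
  have hV := ProbabilityTheory.variance_nonneg (fun x => x) μ
  rw [Measure.real, mscale_Iic hs]
  refine (ENNReal.toReal_mono ENNReal.ofReal_ne_top ((measure_mono ?_).trans h)).trans ?_
  · intro x hx
    simp only [Set.mem_Iic, Set.mem_ofPred_eq] at hx ⊢
    rw [le_div_iff₀ hs] at hx
    rw [div_le_iff₀ hs, abs_sub_comm]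
    refine le_trans ?_ (mul_le_mul_of_nonneg_right (le_abs_self _) hs.le)
    nlinarith
  · rw [ENNReal.toReal_ofReal (by positivity)]
    apply le_of_eq
    field_simp

/-! ## Two-point lotteries -/

/-- The lottery paying `c` with probability `p` and `0` otherwise. -/
def twoPoint (p c : ℝ) : Measure ℝ :=
  ENNReal.ofReal (1 - p) • Measure.dirac 0 + ENNReal.ofReal p • Measure.dirac c

lemma twoPoint_isLottery {p : ℝ} (hp : 0 ≤ p) (hp1 : p ≤ 1) (c : ℝ) :
    IsLottery (twoPoint p c) := by
  refine ⟨⟨?_⟩, min 0 c, max 0 c, ?_⟩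
  · simp [twoPoint, ← ENNReal.ofReal_add (sub_nonneg.2 hp1) hp]
  · simp [twoPoint]

lemma mneg_twoPoint (p c : ℝ) : mneg (twoPoint p c) = twoPoint p (-c) := by
  rw [twoPoint, mneg, mscale, Measure.map_add _ _ (by fun_prop), Measure.map_smul,
    Measure.map_smul]
  have h := mneg_dirac
  simp only [mneg, mscale] at h
  rw [h, h, neg_zero, twoPoint]

lemma ofReal_smul_add_real_apply (μ ν : Measure ℝ) [IsFiniteMeasure μ] [IsFiniteMeasure ν]
    {p q : ℝ} (hp : 0 ≤ p) (hq : 0 ≤ q) (s : Set ℝ) :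
    (ENNReal.ofReal p • μ + ENNReal.ofReal q • ν).real s = p * μ.real s + q * ν.real s := by
  have := μ.smul_finite (ENNReal.ofReal_ne_top (r := p))
  have := ν.smul_finite (ENNReal.ofReal_ne_top (r := q))
  rw [measureReal_add_apply, measureReal_ennreal_smul_apply, measureReal_ennreal_smul_apply,
    ENNReal.toReal_ofReal hp, ENNReal.toReal_ofReal hq]

lemma dirac_real_Iic (a t : ℝ) :
    (Measure.dirac a).real (Set.Iic t) = if a ≤ t then 1 else 0 := by
  rw [Measure.real, Measure.dirac_apply' _ measurableSet_Iic]
  by_cases h : a ≤ t <;> simp [h]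

lemma twoPoint_real_Iic {p : ℝ} (hp : 0 ≤ p) (hp1 : p ≤ 1) (c t : ℝ) :
    (twoPoint p c).real (Set.Iic t)
      = (1 - p) * (if 0 ≤ t then 1 else 0) + p * (if c ≤ t then 1 else 0) := by
  rw [twoPoint, ofReal_smul_add_real_apply _ _ (sub_nonneg.2 hp1) hp, dirac_real_Iic,
    dirac_real_Iic]

lemma mconv_dirac_real_Iic (μ : Measure ℝ) [SFinite μ] (c t : ℝ) :
    (mconv μ (Measure.dirac c)).real (Set.Iic t) = μ.real (Set.Iic (t - c)) := by
  rw [Measure.real, mconv, Measure.prod_dirac, Measure.map_map (by fun_prop) (by fun_prop),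
    Measure.map_apply (by fun_prop) measurableSet_Iic, Measure.real]
  congr 2
  ext x
  simp [le_sub_iff_add_le]

lemma mconv_twoPoint_real_Iic (μ : Measure ℝ) [IsProbabilityMeasure μ] {p : ℝ} (hp : 0 ≤ p)
    (hp1 : p ≤ 1) (c t : ℝ) :
    (mconv μ (twoPoint p c)).real (Set.Iic t)
      = (1 - p) * μ.real (Set.Iic t) + p * μ.real (Set.Iic (t - c)) := by
  have h : mconv μ (twoPoint p c) = ENNReal.ofReal (1 - p) • mconv μ (Measure.dirac 0)
      + ENNReal.ofReal p • mconv μ (Measure.dirac c) := by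
    rw [mconv, twoPoint, Measure.prod_add, Measure.prod_smul_right, Measure.prod_smul_right,
      Measure.map_add _ _ (by fun_prop), Measure.map_smul, Measure.map_smul, mconv, mconv]
  have (x : ℝ) : IsProbabilityMeasure (mconv μ (Measure.dirac x)) :=
    Measure.isProbabilityMeasure_map (by fun_prop)
  rw [h, ofReal_smul_add_real_apply _ _ (sub_nonneg.2 hp1) hp, mconv_dirac_real_Iic,
    mconv_dirac_real_Iic, sub_zero]

lemma FOSDgeM.of_real {μ ν : Measure ℝ} [IsFiniteMeasure μ] [IsFiniteMeasure ν]
    (h : ∀ t, μ.real (Set.Iic t) ≤ ν.real (Set.Iic t)) : FOSDgeM μ ν := fun t =>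
  (ENNReal.toReal_le_toReal (measure_ne_top _ _) (measure_ne_top _ _)).1 (h t)

/-- A lottery dominates the sum of a sure amount `x`, a loss of `d` with probability `δ` and a
gain of `e` with probability `η`, if it never falls below `x - d`, rarely falls below `x`, and
exceeds `x + e` often enough. -/
lemma dominates_sum_twoPoint {ν : Measure ℝ} (hν : IsLottery ν) {x d e δ η : ℝ} (hd : 0 ≤ d)
    (hδ : 0 ≤ δ) (hδ1 : δ ≤ 1) (hη : 0 ≤ η) (hη2 : η ≤ 1 / 2)
    (hlow : ν (Set.Iio (x - d)) = 0) (hmid : ν.real (Set.Iic x) ≤ δ / 2)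
    (hhigh : η ≤ ν.real (Set.Ioi (x + e))) :
    FOSDgeM ν (mconv (mconv (Measure.dirac x) (twoPoint δ (-d))) (twoPoint η e)) := by
  have := hν.prob
  have hη1 : η ≤ 1 := by linarith
  have hL : IsLottery (mconv (Measure.dirac x) (twoPoint δ (-d))) :=
    (IsLottery.dirac x).mconv (twoPoint_isLottery hδ hδ1 _)
  have := hL.prob
  have := (hL.mconv (twoPoint_isLottery hη hη1 e)).prob
  refine .of_real fun t => ?_
  rw [mconv_twoPoint_real_Iic _ hη hη1, mconv_twoPoint_real_Iic _ hδ hδ1,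
    mconv_twoPoint_real_Iic _ hδ hδ1]
  simp only [dirac_real_Iic]
  have hge : (0 : ℝ) ≤ if x ≤ t - e then 1 else 0 := by split_ifs <;> norm_num
  have hge' : (0 : ℝ) ≤ if x ≤ t - e - -d then 1 else 0 := by split_ifs <;> norm_num
  have hδ' : 0 ≤ 1 - δ := by linarith
  have hη' : 0 ≤ 1 - η := by linarith
  rcases lt_or_ge t (x - d) with h1 | h1
  · have h0 : ν.real (Set.Iic t) = 0 := by
      rw [Measure.real, measure_mono_null (Set.Iic_subset_Iio.2 h1) hlow, ENNReal.toReal_zero]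
    rw [h0, if_neg (by linarith : ¬ x ≤ t), if_neg (by linarith : ¬ x ≤ t - -d)]
    nlinarith [mul_nonneg hδ' hge, mul_nonneg hδ hge',
      mul_nonneg hη (add_nonneg (mul_nonneg hδ' hge) (mul_nonneg hδ hge'))]
  rw [if_pos (by linarith : x ≤ t - -d)]
  have hR := mul_nonneg hη (add_nonneg (mul_nonneg hδ' hge) (mul_nonneg hδ hge'))
  rcases lt_or_ge t x with h2 | h2
  · rw [if_neg (by linarith : ¬ x ≤ t)]
    have h3 : ν.real (Set.Iic t) ≤ ν.real (Set.Iic x) :=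
      measureReal_mono (Set.Iic_subset_Iic.2 h2.le)
    nlinarith [mul_nonneg hδ (sub_nonneg.2 hη2)]
  rw [if_pos h2]
  rcases lt_or_ge t (x + e) with h3 | h3
  · have h4 : ν.real (Set.Iic t) ≤ 1 - ν.real (Set.Ioi (x + e)) := by
      rw [← probReal_compl_eq_one_sub measurableSet_Ioi, Set.compl_Ioi]
      exact measureReal_mono (Set.Iic_subset_Iic.2 h3.le)
    linarith
  · rw [if_pos (by linarith : x ≤ t - e), if_pos (by linarith : x ≤ t - e - -d)]
    have : ν.real (Set.Iic t) ≤ 1 := measureReal_le_one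
    linarith

/-! ## Monotone additive statistics -/

section MASm

variable {Φ : Measure ℝ → ℝ}

lemma MASm.map_dirac (hΦ : MASm Φ) (c : ℝ) : Φ (Measure.dirac c) = c := hΦ.1 c

lemma MASm.map_mconv (hΦ : MASm Φ) {μ ν : Measure ℝ} (hμ : IsLottery μ) (hν : IsLottery ν) :
    Φ (mconv μ ν) = Φ μ + Φ ν := hΦ.2.1 μ ν hμ.prob hν.prob hμ.supp hν.supp

lemma MASm.mono (hΦ : MASm Φ) {μ ν : Measure ℝ} (hμ : IsLottery μ) (hν : IsLottery ν)
    (h : FOSDgeM μ ν) : Φ ν ≤ Φ μ := hΦ.2.2 μ ν hμ.prob hν.prob hμ.supp hν.supp h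

lemma MASm.map_npow (hΦ : MASm Φ) {μ : Measure ℝ} (hμ : IsLottery μ) (n : ℕ) :
    Φ (npow μ n) = n * Φ μ := by
  induction n with
  | zero => simpa [npow] using hΦ.map_dirac 0
  | succ n ih =>
    rw [npow, hΦ.map_mconv (hμ.npow n) hμ, ih]
    push_cast
    ring

/-- The reflected statistic `X ↦ -Φ[-X]` is again monotone and additive. -/
lemma MASm.reflect (hΦ : MASm Φ) : MASm fun μ => -Φ (mneg μ) := by
  refine ⟨fun c => ?_, fun μ ν hμ hν hμ' hν' => ?_, fun μ ν hμ hν hμ' hν' h => ?_⟩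
  · simp [mneg_dirac, hΦ.map_dirac]
  · have h := hΦ.map_mconv (IsLottery.mneg ⟨hμ, hμ'⟩) (IsLottery.mneg ⟨hν, hν'⟩)
    rw [mneg, mneg, ← mscale_mconv, ← mneg, ← mneg, ← mneg] at h
    linarith
  · exact neg_le_neg (hΦ.mono (IsLottery.mneg ⟨hν, hν'⟩) (IsLottery.mneg ⟨hμ, hμ'⟩) h.mneg)

lemma MASm.twoPoint_nonneg (hΦ : MASm Φ) {p c : ℝ} (hp : 0 ≤ p) (hp1 : p ≤ 1) (hc : 0 ≤ c) :
    0 ≤ Φ (twoPoint p c) := by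
  have hB := twoPoint_isLottery hp hp1 c
  have := hB.prob
  rw [← hΦ.map_dirac 0]
  refine hΦ.mono hB (.dirac 0) (.of_real fun t => ?_)
  rw [dirac_real_Iic, twoPoint_real_Iic hp hp1]
  split_ifs <;> linarith

lemma MASm.twoPoint_mul_le (hΦ : MASm Φ) {p q c d : ℝ} (hp : 0 ≤ p) (hp1 : p ≤ 1) (hq : 0 ≤ q)
    (hq1 : q ≤ 1) (hc : 0 ≤ c) (hd : 0 ≤ d) :
    Φ (twoPoint (p * q) (c + d)) ≤ Φ (twoPoint p c) + Φ (twoPoint q d) := by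
  have hpq := mul_nonneg hp hq
  have hpq1 := mul_le_one₀ hp1 hq hq1
  have hP := twoPoint_isLottery hp hp1 c
  have hQ := twoPoint_isLottery hq hq1 d
  have hPQ := twoPoint_isLottery hpq hpq1 (c + d)
  have := hP.prob
  have := hPQ.prob
  have := (hP.mconv hQ).prob
  rw [← hΦ.map_mconv hP hQ]
  refine hΦ.mono (hP.mconv hQ) hPQ (.of_real fun t => ?_)
  rw [mconv_twoPoint_real_Iic _ hq hq1, twoPoint_real_Iic hp hp1, twoPoint_real_Iic hp hp1,
    twoPoint_real_Iic hpq hpq1]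
  have hp' := sub_nonneg.2 hp1
  have hq' := sub_nonneg.2 hq1
  split_ifs <;> nlinarith [mul_nonneg hp' hq, mul_nonneg hp' hq', mul_nonneg hp hq']

lemma MASm.le_twoPoint_half (hΦ : MASm Φ) {p c d : ℝ} (hp : 0 ≤ p) (hp1 : p ≤ 1)
    (hc : 0 ≤ c) (hd : 0 ≤ d) :
    Φ (twoPoint (p / 2) c) + Φ (twoPoint (p / 2) d) ≤ Φ (twoPoint p (c + d)) := by
  have hq : 0 ≤ p / 2 := by linarith
  have hq1 : p / 2 ≤ 1 := by linarith
  have hC := twoPoint_isLottery hq hq1 c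
  have hD := twoPoint_isLottery hq hq1 d
  have hP := twoPoint_isLottery hp hp1 (c + d)
  have := hC.prob
  have := hP.prob
  have := (hC.mconv hD).prob
  rw [← hΦ.map_mconv hC hD]
  refine hΦ.mono hP (hC.mconv hD) (.of_real fun t => ?_)
  rw [mconv_twoPoint_real_Iic _ hq hq1, twoPoint_real_Iic hq hq1, twoPoint_real_Iic hq hq1,
    twoPoint_real_Iic hp hp1]
  split_ifs <;> nlinarith [mul_nonneg hp hp, mul_nonneg hp (sub_nonneg.2 hp1)]

lemma eq_mul_of_additive_nonneg {f : ℝ → ℝ} (hf0 : ∀ x, 0 ≤ x → 0 ≤ f x)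
    (hadd : ∀ x y, 0 ≤ x → 0 ≤ y → f (x + y) = f x + f y) {x : ℝ} (hx : 0 ≤ x) :
    f x = f 1 * x := by
  have hmono : ∀ {a b : ℝ}, 0 ≤ a → a ≤ b → f a ≤ f b := fun {a b} ha hab => by
    have h := hadd a (b - a) ha (sub_nonneg.2 hab)
    rw [add_sub_cancel] at h
    linarith [hf0 (b - a) (sub_nonneg.2 hab)]
  have hnat : ∀ {y : ℝ} (_ : 0 ≤ y) (n : ℕ), f (n * y) = n * f y := fun {y} hy n => by
    induction n with
    | zero =>
      have h := hadd 0 0 le_rfl le_rfl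
      simp only [add_zero] at h
      simp only [Nat.cast_zero, zero_mul]
      linarith
    | succ n ih =>
      rw [Nat.cast_add_one, add_one_mul, hadd _ _ (by positivity) hy, ih]
      ring
  have hbound : ∀ n : ℕ, n * |f x - f 1 * x| ≤ f 1 := fun n => by
    have hnx : 0 ≤ n * x := by positivity
    have h1 := hmono (by positivity) (Nat.floor_le hnx)
    have h2 := hmono hnx (Nat.lt_floor_add_one (n * x)).le
    have h3 := hnat zero_le_one ⌊n * x⌋₊
    have h4 := hnat zero_le_one (⌊n * x⌋₊ + 1)
    push_cast at h4
    rw [mul_one] at h3 h4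
    rw [h3, hnat hx] at h1
    rw [h4, hnat hx] at h2
    have h5 := mul_le_mul_of_nonneg_right (Nat.floor_le hnx) (hf0 1 zero_le_one)
    have h6 := mul_le_mul_of_nonneg_right (Nat.lt_floor_add_one (n * x)).le (hf0 1 zero_le_one)
    rw [← Nat.abs_cast n, ← abs_mul, abs_le]
    constructor <;> nlinarith
  by_contra hne
  have hpos : 0 < |f x - f 1 * x| := abs_pos.2 (sub_ne_zero.2 hne)
  obtain ⟨n, hn⟩ := exists_nat_gt (f 1 / |f x - f 1 * x|)
  rw [div_lt_iff₀ hpos] at hn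
  exact (hbound n).not_gt hn

/-- The values of `Φ` at gains of fixed size `c` and vanishing probability decrease to a limit
that is linear in `c`. -/
lemma MASm.exists_slope (hΦ : MASm Φ) : ∃ r : ℝ, 0 ≤ r ∧ ∀ c, 0 ≤ c →
    (∀ p ∈ Set.Ioc (0 : ℝ) 1, r * c ≤ Φ (twoPoint p c)) ∧
      ∀ ε > 0, ∃ p ∈ Set.Ioc (0 : ℝ) 1, Φ (twoPoint p c) < r * c + ε := by
  set f : ℝ → ℝ := fun c => ⨅ p : Set.Ioc (0 : ℝ) 1, Φ (twoPoint p c) with hf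
  have : Nonempty (Set.Ioc (0 : ℝ) 1) := ⟨1, by norm_num⟩
  have hbdd : ∀ {c : ℝ}, 0 ≤ c →
      BddBelow (Set.range fun p : Set.Ioc (0 : ℝ) 1 => Φ (twoPoint p c)) := fun hc =>
    ⟨0, by rintro _ ⟨p, rfl⟩; exact hΦ.twoPoint_nonneg p.2.1.le p.2.2 hc⟩
  have hle : ∀ {c p : ℝ}, 0 ≤ c → 0 < p → p ≤ 1 → f c ≤ Φ (twoPoint p c) :=
    fun hc hp hp1 => ciInf_le (hbdd hc) ⟨_, hp, hp1⟩
  have hnn : ∀ c, 0 ≤ c → 0 ≤ f c := fun c hc =>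
    le_ciInf fun p => hΦ.twoPoint_nonneg p.2.1.le p.2.2 hc
  have hlin : ∀ {c : ℝ}, 0 ≤ c → f c = f 1 * c := by
    refine fun {c} hc => eq_mul_of_additive_nonneg hnn (fun c d hc hd => le_antisymm ?_ ?_) hc
    · refine le_ciInf_add_ciInf fun p q => ?_
      exact (hle (add_nonneg hc hd) (mul_pos p.2.1 q.2.1)
        (mul_le_one₀ p.2.2 q.2.1.le q.2.2)).trans
        (hΦ.twoPoint_mul_le p.2.1.le p.2.2 q.2.1.le q.2.2 hc hd)
    · refine le_ciInf fun p => (add_le_add ?_ ?_).trans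
        (hΦ.le_twoPoint_half p.2.1.le p.2.2 hc hd)
      · exact hle hc (half_pos p.2.1) (by linarith [p.2.1, p.2.2])
      · exact hle hd (half_pos p.2.1) (by linarith [p.2.1, p.2.2])
  refine ⟨f 1, hnn 1 zero_le_one, fun c hc => ⟨fun p hp => ?_, fun ε hε => ?_⟩⟩
  · rw [← hlin hc]
    exact hle hc hp.1 hp.2
  · rw [← hlin hc]
    obtain ⟨p, hp⟩ := exists_lt_of_ciInf_lt (lt_add_of_pos_right (f c) hε)
    exact ⟨p, p.2, hp⟩

lemma MASm.map_mscale_pow {b : ℝ} (hb : 0 < b)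
    (hsc : ∀ μ, IsLottery μ → Φ (mscale b μ) = b * Φ μ) {μ : Measure ℝ} (hμ : IsLottery μ)
    (k : ℕ) : Φ (mscale (b ^ k) μ) = b ^ k * Φ μ := by
  induction k with
  | zero => simp [mscale_one]
  | succ k ih =>
    rw [pow_succ', ← mscale_mscale, hsc _ (hμ.mscale (pow_pos hb k)), ih, mul_assoc]

/-- The lower bound on a scale invariant monotone additive statistic given by its responses
to unlikely losses and unlikely gains. -/
lemma MASm.le_of_slopes (hΦ : MASm Φ) {b : ℝ} (hb : 0 < b) (hb1 : b < 1)
    (hsc : ∀ μ, IsLottery μ → Φ (mscale b μ) = b * Φ μ) {r r' : ℝ}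
    (hr : ∀ c, 0 ≤ c → ∀ p ∈ Set.Ioc (0 : ℝ) 1, r * c ≤ Φ (twoPoint p c))
    (hr' : ∀ c, 0 ≤ c → ∀ ε > 0, ∃ p ∈ Set.Ioc (0 : ℝ) 1, -Φ (mneg (twoPoint p c)) < r' * c + ε)
    {μ : Measure ℝ} (hμ : IsLottery μ) :
    ∫ x, x ∂μ - r' * (∫ x, x ∂μ - minSupp μ) + r * (maxSupp μ - ∫ x, x ∂μ) ≤ Φ μ := by
  set E := ∫ x, x ∂μ with hE
  set m := minSupp μ with hm
  set M := maxSupp μ with hM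
  set V := ProbabilityTheory.variance (fun x => x) μ with hV
  have hd : 0 ≤ E - m := sub_nonneg.2 hμ.minSupp_le_integral
  have he : 0 ≤ M - E := sub_nonneg.2 hμ.integral_le_maxSupp
  refine le_of_forall_pos_le_add fun ε hε => ?_
  obtain ⟨δ, ⟨hδ, hδ1⟩, hδr⟩ := hr' _ hd (ε / 2) (half_pos hε)
  have hε4 : 0 < ε / 4 := by linarith
  have hpow : Tendsto (fun k : ℕ => b ^ k) atTop (𝓝 0) :=
    tendsto_pow_atTop_nhds_zero_of_lt_one hb.le hb1
  have hN : Tendsto (fun k : ℕ => b ^ k * (⌈(b ^ k)⁻¹⌉₊ : ℝ)) atTop (𝓝 1) := by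
    have hinv : Tendsto (fun k : ℕ => (b ^ k)⁻¹) atTop atTop :=
      tendsto_inv_nhdsGT_zero.comp
        (tendsto_nhdsWithin_iff.2 ⟨hpow, .of_forall fun k => pow_pos hb k⟩)
    refine ((tendsto_nat_ceil_div_atTop (R := ℝ)).comp hinv).congr fun k => ?_
    simp [div_inv_eq_mul, mul_comm]
  have hlim : Tendsto (fun k : ℕ => b ^ k * (⌈(b ^ k)⁻¹⌉₊ : ℝ) * Φ μ) atTop (𝓝 (Φ μ)) := by
    simpa using hN.mul_const (Φ μ)
  rw [← sub_le_iff_le_add]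
  refine ge_of_tendsto hlim ?_
  have ev₁ : ∀ᶠ k : ℕ in atTop, m - ε / 2 < b ^ k * (⌈(b ^ k)⁻¹⌉₊ : ℝ) * (m - ε / 4) := by
    refine (hN.mul_const (m - ε / 4)).eventually (lt_mem_nhds ?_)
    linarith
  have ev₂ : ∀ᶠ k : ℕ in atTop, E - ε / 4 < b ^ k * (⌈(b ^ k)⁻¹⌉₊ : ℝ) * E := by
    refine (hN.mul_const E).eventually (lt_mem_nhds ?_)
    linarith
  have ev₃ : ∀ᶠ k : ℕ in atTop, M - ε / 2 < b ^ k * (⌈(b ^ k)⁻¹⌉₊ : ℝ) * (M - ε / 4) := by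
    refine (hN.mul_const (M - ε / 4)).eventually (lt_mem_nhds ?_)
    linarith
  have ev₄ : ∀ᶠ k : ℕ in atTop,
      b ^ k * (b ^ k * (⌈(b ^ k)⁻¹⌉₊ : ℝ)) * V / (ε / 4) ^ 2 < δ / 2 := by
    refine (((hpow.mul hN).mul_const V).div_const ((ε / 4) ^ 2)).eventually (gt_mem_nhds ?_)
    simp [hδ]
  filter_upwards [ev₁, ev₂, ev₃, ev₄] with k h₁ h₂ h₃ h₄
  set s := b ^ k with hs_def
  have hs : 0 < s := pow_pos hb k
  obtain ⟨n, hn⟩ : ∃ n, ⌈s⁻¹⌉₊ = n + 1 :=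
    Nat.exists_eq_succ_of_ne_zero (Nat.ceil_pos.2 (inv_pos.2 hs)).ne'
  set N := ⌈s⁻¹⌉₊ with hN_def
  have hX := hμ.npow N
  have hν : IsLottery (mscale s (npow μ N)) := hX.mscale hs
  have := hν.prob
  have hΦν : Φ (mscale s (npow μ N)) = s * N * Φ μ := by
    rw [MASm.map_mscale_pow hb hsc hX, hΦ.map_npow hμ, mul_assoc]
  rw [← hΦν]
  have hlow : mscale s (npow μ N) (Set.Iio (E - ε / 2 - (E - m))) = 0 := by
    rw [mscale_Iio hs]
    refine measure_mono_null (Set.Iio_subset_Iio ?_)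
      (npow_Iio_eq_zero hμ (hμ.Iio_eq_zero (a := m - ε / 4) (by linarith)) N)
    rw [div_le_iff₀' hs]
    linarith
  have hmid : (mscale s (npow μ N)).real (Set.Iic (E - ε / 2)) ≤ δ / 2 :=
    (mscale_npow_Iic_le hμ hs N hε4 (by linarith)).trans h₄.le
  have hhigh : 0 < (mscale s (npow μ N)).real (Set.Ioi (E - ε / 2 + (M - E))) := by
    refine ENNReal.toReal_pos (fun h0 => ?_) (measure_ne_top _ _)
    rw [mscale_Ioi hs] at h0
    have h := npow_succ_Ioi_ne_zero hμ (hμ.Ioi_ne_zero (a := M - ε / 4) (by linarith)) n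
    rw [← hn] at h
    refine h (measure_mono_null (Set.Ioi_subset_Ioi ?_) h0)
    rw [div_le_iff₀' hs]
    linarith
  set η := min ((mscale s (npow μ N)).real (Set.Ioi (E - ε / 2 + (M - E)))) (1 / 2)
  have hη : 0 < η := lt_min hhigh (by norm_num)
  have hη2 : η ≤ 1 / 2 := min_le_right _ _
  have hη1 : η ≤ 1 := by linarith
  have hL := twoPoint_isLottery hδ.le hδ1 (-(E - m))
  have hR := twoPoint_isLottery hη.le hη1 (M - E)
  have hxL := (IsLottery.dirac (E - ε / 2)).mconv hL
  have key := hΦ.mono hν (hxL.mconv hR)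
    (dominates_sum_twoPoint hν hd hδ.le hδ1 hη.le hη2 hlow hmid (min_le_left _ _))
  rw [hΦ.map_mconv hxL hR, hΦ.map_mconv (.dirac _) hL, hΦ.map_dirac] at key
  rw [mneg_twoPoint] at hδr
  linarith [hr _ he η ⟨hη, hη1⟩]

/-- A monotone additive statistic that is homogeneous for some scale `b < 1` is a convex
combination of the minimum, the expectation and the maximum. -/
lemma MASm.exists_convex_combination (hΦ : MASm Φ) {b : ℝ} (hb : 0 < b) (hb1 : b < 1)
    (hsc : ∀ μ, IsLottery μ → Φ (mscale b μ) = b * Φ μ) :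
    ∃ l1 l2 l3 : ℝ, 0 ≤ l1 ∧ 0 ≤ l2 ∧ 0 ≤ l3 ∧ l1 + l2 + l3 = 1 ∧
      ∀ μ, IsLottery μ → Φ μ = l1 * minSupp μ + l2 * (∫ x, x ∂μ) + l3 * maxSupp μ := by
  obtain ⟨r, hr0, hr⟩ := hΦ.exists_slope
  obtain ⟨r', hr0', hr'⟩ := hΦ.reflect.exists_slope
  refine ⟨r', 1 - r - r', r, hr0', ?_, hr0, by ring, fun μ hμ => le_antisymm ?_ ?_⟩
  · have hp : (1 / 2 : ℝ) ∈ Set.Ioc (0 : ℝ) 1 := by norm_num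
    have h₁ := (hr 1 zero_le_one).1 _ hp
    have h₂ := (hr' 1 zero_le_one).1 _ hp
    have hB := twoPoint_isLottery hp.1.le hp.2 1
    have hC := twoPoint_isLottery hp.1.le hp.2 (-1)
    have hCd := hC.mconv (.dirac 1)
    have := hB.prob
    have := hC.prob
    have := hCd.prob
    have h₃ := hΦ.mono hCd hB <| .of_real fun t => by
      rw [mconv_dirac_real_Iic, twoPoint_real_Iic hp.1.le hp.2, twoPoint_real_Iic hp.1.le hp.2]
      have e₁ : (0 ≤ t - 1) = (1 ≤ t) := by simp
      have e₂ : (-1 ≤ t - 1) = (0 ≤ t) := by simp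
      simp only [e₁, e₂]
      linarith
    rw [hΦ.map_mconv hC (.dirac 1), hΦ.map_dirac] at h₃
    rw [mneg_twoPoint] at h₂
    linarith
  · have hsc' : ∀ ν, IsLottery ν → -Φ (mneg (mscale b ν)) = b * -Φ (mneg ν) := fun ν hν => by
      rw [mneg, mscale_mscale, mul_comm, ← mscale_mscale, ← mneg, hsc _ hν.mneg]
      ring
    have h := hΦ.reflect.le_of_slopes hb hb1 hsc' (fun c hc => (hr' c hc).1)
      (fun c hc => by simpa only [mneg_mneg, neg_neg] using (hr c hc).2) hμ.mneg
    rw [integral_mneg, minSupp_mneg, maxSupp_mneg, mneg_mneg] at h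
    linarith
  · have h := hΦ.le_of_slopes hb hb1 hsc (fun c hc => (hr c hc).1) (fun c hc => (hr' c hc).2) hμ
    linarith

end MASm

/-- a positively homogeneous (for some scale `β ≠ 1`) monotone additive
statistic is a convex combination of the minimum, expectation, and maximum. -/
theorem stmt13 (Φ : Measure ℝ → ℝ) (hΦ : MASm Φ) (β : ℝ) (hβ : 0 < β) (hβ1 : β ≠ 1)
    (hsc : ∀ μ : Measure ℝ, IsProbabilityMeasure μ → CompSupp μ →
      Φ (mscale β μ) = β * Φ μ) :
    ∃ l1 l2 l3 : ℝ, 0 ≤ l1 ∧ 0 ≤ l2 ∧ 0 ≤ l3 ∧ l1 + l2 + l3 = 1 ∧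
      ∀ μ : Measure ℝ, IsProbabilityMeasure μ → CompSupp μ →
        Φ μ = l1 * minSupp μ + l2 * (∫ x, x ∂μ) + l3 * maxSupp μ := by
  have hsc' : ∀ μ, IsLottery μ → Φ (mscale β μ) = β * Φ μ := fun μ hμ => hsc μ hμ.prob hμ.supp
  have key : ∃ b : ℝ, 0 < b ∧ b < 1 ∧ ∀ μ, IsLottery μ → Φ (mscale b μ) = b * Φ μ := by
    rcases lt_or_gt_of_ne hβ1 with h | h
    · exact ⟨β, hβ, h, hsc'⟩
    · refine ⟨β⁻¹, inv_pos.2 hβ, inv_lt_one_of_one_lt₀ h, fun μ hμ => ?_⟩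
      have h' := hsc' _ (hμ.mscale (inv_pos.2 hβ))
      rw [mscale_mscale, mul_inv_cancel₀ hβ.ne', mscale_one] at h'
      rw [h', inv_mul_cancel_left₀ hβ.ne']
  obtain ⟨b, hb, hb1, hscb⟩ := key
  obtain ⟨l1, l2, l3, h1, h2, h3, hsum, h⟩ := hΦ.exists_convex_combination hb hb1 hscb
  exact ⟨l1, l2, l3, h1, h2, h3, hsum, fun μ hμ hμ' => h μ ⟨hμ, hμ'⟩⟩

end Paper
end
end

section
/- Consider the two-player game with action sets A_1={a_1,b_1}, A_2={a_2,b_2} and payoffs u_1(a_1,a_2)=2, u_1(a_1,b_2)=0, u_1(b_1,a_2)=−1, u_1(b_1,b_2)=1, u_2(a_1,a_2)=0, u_2(a_1,b_2)=1, u_2(b_1,a_2)=1, u_2(b_1,b_2)=0. For every mixed strategy profile p=(p_1,p_2), there exist a player i and actions a_i, b_i ∈ A_i such that p_i(b_i) > 0, min(supp u_i(b_i,p_{-i})) < min(supp u_i(a_i,p_{-i})), and max(supp u_i(b_i,p_{-i})) < max(supp u_i(a_i,p_{-i})). -/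
open Filter Topology MeasureTheory

noncomputable section

namespace Paper

/-- Player 1's payoffs in the variant of matching pennies of Table 3
(`true` = `a_i`, `false` = `b_i`). -/
def u1Game15 : Bool → Bool → ℝ := fun a b =>
  if a then (if b then 2 else 0) else (if b then -1 else 1)

/-- Player 2's payoffs in the variant of matching pennies of Table 3. -/
def u2Game15 : Bool → Bool → ℝ := fun a b =>
  if a then (if b then 0 else 1) else (if b then 1 else 0)

theorem support_two_point_of_pos {x y a b : ℝ} (ha : 0 < a) (hb : 0 < b) :
    Function.support (fun t : ℝ => (if x = t then a else 0) + if y = t then b else 0) =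
      {x, y} := by
  ext t
  simp only [Function.mem_support, Set.mem_insert_iff, Set.mem_singleton_iff, eq_comm (a := t)]
  split_ifs with h₁ h₂ h₂ <;> simp [h₁, h₂, ha.ne', hb.ne', (add_pos ha hb).ne']

theorem support_one_point_of_pos {x a : ℝ} (ha : 0 < a) :
    Function.support (fun t : ℝ => if x = t then a else 0) = {x} := by
  ext t
  simp [ha.ne', eq_comm]

theorem support_mass1_of_pos (u : Bool → Bool → ℝ) {q : Bool → ℝ} (ht : 0 < q true)
    (hf : 0 < q false) (a : Bool) :
    Function.support (mass1 u q a) = {u a true, u a false} := by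
  rw [← support_two_point_of_pos ht hf]
  unfold mass1
  simp only [Fintype.sum_bool]

theorem support_mass1_of_pure {u : Bool → Bool → ℝ} {q : Bool → ℝ} {b : Bool} (hb : 0 < q b)
    (h : q (!b) = 0) (a : Bool) : Function.support (mass1 u q a) = {u a b} := by
  rw [← support_one_point_of_pos hb]
  unfold mass1
  cases b <;> simp_all

theorem support_mass2_of_pure {u : Bool → Bool → ℝ} {p : Bool → ℝ} {a : Bool} (ha : 0 < p a)
    (h : p (!a) = 0) (b : Bool) : Function.support (mass2 u p b) = {u a b} := by
  rw [← support_one_point_of_pos ha]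
  unfold mass2
  cases a <;> simp_all

/-- in the variant of matching pennies, for every mixed strategy profile
some player plays with positive probability an action whose payoff lottery has strictly
lower minimum and strictly lower maximum than that of another of their actions. -/
theorem stmt15 (p q : Bool → ℝ) (hp : IsDist p) (hq : IsDist q) :
    (∃ ai bi : Bool, 0 < p bi ∧
      sInf (Function.support (mass1 u1Game15 q bi)) <
        sInf (Function.support (mass1 u1Game15 q ai)) ∧
      sSup (Function.support (mass1 u1Game15 q bi)) <
        sSup (Function.support (mass1 u1Game15 q ai))) ∨
    (∃ ai bi : Bool, 0 < q bi ∧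
      sInf (Function.support (mass2 u2Game15 p bi)) <
        sInf (Function.support (mass2 u2Game15 p ai)) ∧
      sSup (Function.support (mass2 u2Game15 p bi)) <
        sSup (Function.support (mass2 u2Game15 p ai))) := by
  obtain ⟨hp0, hp1⟩ := hp
  obtain ⟨hq0, hq1⟩ := hq
  rw [Fintype.sum_bool] at hp1 hq1
  rcases (hq0 true).eq_or_lt' with hqt | hqt
  · have hqf : 0 < q false := by linarith
    rcases (hp0 true).eq_or_lt' with hpt | hpt
    · have hpf : 0 < p false := by linarith
      refine Or.inr ⟨true, false, hqf, ?_⟩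
      simp only [support_mass2_of_pure hpf hpt, csInf_singleton, csSup_singleton]
      norm_num [u2Game15]
    · refine Or.inl ⟨false, true, hpt, ?_⟩
      simp only [support_mass1_of_pure hqf hqt, csInf_singleton, csSup_singleton]
      norm_num [u1Game15]
  · rcases (hp0 false).eq_or_lt' with hpf | hpf
    · have hpt : 0 < p true := by linarith
      refine Or.inr ⟨false, true, hqt, ?_⟩
      simp only [support_mass2_of_pure hpt hpf, csInf_singleton, csSup_singleton]
      norm_num [u2Game15]
    · refine Or.inl ⟨true, false, hpf, ?_⟩
      rcases (hq0 false).eq_or_lt' with hqf | hqf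
      · simp only [support_mass1_of_pure hqt hqf, csInf_singleton, csSup_singleton]
        norm_num [u1Game15]
      · simp only [support_mass1_of_pos _ hqt hqf, csInf_pair, csSup_pair]
        norm_num [u1Game15]

end Paper
end
end
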